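/- If G is a triangulated planar graph (a plane graph in which every face, including the outer face, is a 3-cycle), then the list 3-dynamic chromatic number of G is at most 6. -/

import Mathlib

open SimpleGraph

/-- A rotation system on a finite connected simple graph: a permutation of the darts that
fixes the tail of each dart and acts transitively on the darts with a given tail
(i.e. a cyclic order of the darts around each vertex). -/
structure RotationSystem (V : Type) [Fintype V] [DecidableEq V] where
  graph : SimpleGraph V
  conn : graph.Connected
  rot : Equiv.Perm graph.Dart
  rot_fst : ∀ d : graph.Dart, (rot d).fst = d.fst
  rot_orbit : ∀ d e : graph.Dart, d.fst = e.fst → ∃ n : ℕ, (rot ^ n) d = e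

namespace RotationSystem

variable {V : Type} [Fintype V] [DecidableEq V] (P : RotationSystem V)

/-- The face-traversal permutation of the darts. -/
def facePerm : Equiv.Perm P.graph.Dart :=
  (Function.Involutive.toPerm _ (Dart.symm_involutive (G := P.graph))).trans P.rot

/-- Two darts lie on (the boundary walk of) the same face. -/
def SameFace (d e : P.graph.Dart) : Prop := P.facePerm.SameCycle d e

/-- The faces of the embedding, as orbits of the face-traversal permutation. -/
def faceSetoid : Setoid P.graph.Dart :=
  ⟨P.facePerm.SameCycle,
    ⟨fun x => Equiv.Perm.SameCycle.refl _ x, fun h => h.symm, fun h h' => h.trans h'⟩⟩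

/-- The number of faces of the embedding. -/
noncomputable def numFaces : ℕ := Nat.card (Quotient P.faceSetoid)

/-- The rotation system is a plane (genus zero) embedding: Euler's formula holds. -/
def IsPlane : Prop :=
  (Fintype.card V : ℤ) - Nat.card P.graph.edgeSet + P.numFaces = 2

/-- The number of darts on the boundary walk of the face containing dart `d`. -/
noncomputable def faceSize (d : P.graph.Dart) : ℕ := Set.ncard {e | P.SameFace d e}

end RotationSystem

/-- A near-triangulation: a connected plane graph, with a distinguished (outer) face,
all of whose other (bounded) faces are 3-cycles. -/
structure NearTriangulation (V : Type) [Fintype V] [DecidableEq V]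
    extends RotationSystem V where
  outer : graph.Dart
  plane : toRotationSystem.IsPlane
  bounded_tri : ∀ d : graph.Dart,
    ¬ toRotationSystem.SameFace outer d → toRotationSystem.faceSize d = 3

/-- A vertex lies on the boundary of the outer face. -/
def NearTriangulation.OnOuter {V : Type} [Fintype V] [DecidableEq V]
    (P : NearTriangulation V) (v : V) : Prop :=
  ∃ d : P.graph.Dart, P.toRotationSystem.SameFace P.outer d ∧ d.fst = v

/-- An `r`-dynamic coloring: a proper coloring such that each vertex `v` sees at least
`min r (deg v)` distinct colors on its neighborhood. -/
def IsDynColoring {V : Type} (G : SimpleGraph V) (r : ℕ) (φ : V → ℕ) : Prop :=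
  (∀ ⦃u v : V⦄, G.Adj u v → φ u ≠ φ v) ∧
  ∀ v : V, min r ((G.neighborSet v).ncard) ≤ (φ '' G.neighborSet v).ncard

/-- A triangulated planar graph (maximal planar graph): a connected plane graph all of whose
faces, including the unbounded one, are 3-cycles. -/
structure Triangulation (V : Type) [Fintype V] [DecidableEq V] extends RotationSystem V where
  plane : toRotationSystem.IsPlane
  all_tri : ∀ d : graph.Dart, toRotationSystem.faceSize d = 3

/-- A triangulated sphere with vertex set `S`, given by its oriented triangles: `t x y z` says that
`x, y, z` are the corners of a face in counterclockwise order. Every dart `(x, y)` bounds exactly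
one face on its left, all vertex links are connected, the complex is connected, has trivial first
cohomology over `ZMod 2`, and has few darts. -/
structure IsTriangulatedSphere {V : Type*} [Fintype V] (S : Finset V) (t : V → V → V → Prop) :
    Prop where
  cyc : ∀ {x y z}, t x y z → t y z x
  ne : ∀ {x y z}, t x y z → x ≠ y
  uniq : ∀ {x y z w}, t x y z → t x y w → z = w
  symm : ∀ {x y z}, t x y z → ∃ w, t y x w
  mem_iff : ∀ x, x ∈ S ↔ ∃ y z, t x y z
  link : ∀ v (p : V → Prop), (∀ x y, t v x y → (p x ↔ p y)) →
    ∀ x y x' y', t v x x' → t v y y' → p x → p y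
  conn : ∀ p : V → Prop, (∀ x y z, t x y z → (p x ↔ p y)) → ∀ x ∈ S, ∀ y ∈ S, p x → p y
  exact : ∀ f : V → V → ZMod 2, (∀ x y, f x y = f y x) →
    (∀ x y z, t x y z → f x y + f y z + f z x = 0) →
    ∃ g : V → ZMod 2, ∀ x y z, t x y z → f x y = g x + g y
  count : Nat.card {e : V × V // ∃ z, t e.1 e.2 z} + 12 ≤ 6 * S.card

/-- `(x, y, z)` is a cyclic rotation of `(a, b, c)`. -/
def IsRotation {V : Type*} (a b c x y z : V) : Prop :=
  (x = a ∧ y = b ∧ z = c) ∨ (x = b ∧ y = c ∧ z = a) ∨ (x = c ∧ y = a ∧ z = b)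

/-- Replace the edge `x y`, with adjacent faces `x y z` and `y x w`, by the edge `z w`. -/
def flipEdge {V : Type*} (t : V → V → V → Prop) (x y z w : V) (a b c : V) : Prop :=
  (t a b c ∧ ¬ IsRotation x y z a b c ∧ ¬ IsRotation y x w a b c) ∨
    IsRotation z x w a b c ∨ IsRotation w y z a b c

/-- Remove the vertex `v`, with neighbors `a`, `b`, `c` only, leaving the face `a b c`. -/
def removeVertex {V : Type*} (t : V → V → V → Prop) (v a b c : V) (x y z : V) : Prop :=
  (t x y z ∧ x ≠ v ∧ y ≠ v ∧ z ≠ v) ∨ IsRotation a b c x y z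

lemma exists_three_le_card_insert {α : Type*} [DecidableEq α] {C : Finset α} {p : α}
    (hp : p ∈ C) (hC : 2 ≤ C.card) :
    ∃ x, ∀ c, c ≠ p → c ≠ x → 3 ≤ (insert c C).card := by
  obtain ⟨x, hx, hxp⟩ := Finset.exists_mem_ne hC p
  refine ⟨x, fun c hcp hcx => ?_⟩
  have : ({c, p, x} : Finset α) ⊆ insert c C := by
    intro y
    simp only [Finset.mem_insert, Finset.mem_singleton]
    rintro (rfl | rfl | rfl) <;> simp [hp, hx]
  refine le_trans ?_ (Finset.card_le_card this)
  rw [Finset.card_eq_three.2 ⟨c, p, x, hcp, hcx, hxp.symm, rfl⟩]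

lemma three_le_card_image {V : Type*} {φ : V → ℕ} {C : Finset V} {a b c : V}
    (ha : a ∈ C) (hb : b ∈ C) (hc : c ∈ C)
    (hab : φ a ≠ φ b) (hac : φ a ≠ φ c) (hbc : φ b ≠ φ c) : 3 ≤ (C.image φ).card := by
  have : ({φ a, φ b, φ c} : Finset ℕ) ⊆ C.image φ := by
    simp only [Finset.insert_subset_iff, Finset.singleton_subset_iff]
    exact ⟨Finset.mem_image_of_mem _ ha, Finset.mem_image_of_mem _ hb,
      Finset.mem_image_of_mem _ hc⟩
  exact (Finset.card_eq_three.2 ⟨_, _, _, hab, hac, hbc, rfl⟩).symm.trans_le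
    (Finset.card_le_card this)

lemma exists_injOn_of_card_le {V : Type*} [DecidableEq V] {L : V → Finset ℕ} {n : ℕ}
    (hL : ∀ v, n ≤ (L v).card)
    (S : Finset V) (hS : S.card ≤ n) :
    ∃ φ : V → ℕ, (∀ v ∈ S, φ v ∈ L v) ∧ Set.InjOn φ S := by
  induction S using Finset.induction_on with
  | empty => exact ⟨fun _ => 0, by simp, by simp⟩
  | insert v S hv ih =>
    rw [Finset.card_insert_of_notMem hv] at hS
    obtain ⟨φ, hφL, hφ⟩ := ih (by omega)
    obtain ⟨c, hcL, hc⟩ := Finset.exists_mem_notMem_of_card_lt_card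
      ((Finset.card_image_le (s := S) (f := φ)).trans_lt (hS.trans (hL v)))
    have hupd : ∀ u ∈ S, Function.update φ v c u = φ u := fun u hu =>
      Function.update_of_ne (by rintro rfl; exact hv hu) _ _
    refine ⟨Function.update φ v c, fun u hu => ?_, ?_⟩
    · rcases Finset.mem_insert.1 hu with rfl | hu
      · rwa [Function.update_self]
      · rw [hupd u hu]
        exact hφL u hu
    · rw [Finset.coe_insert, Set.injOn_insert (by simpa using hv)]
      refine ⟨fun x hx y hy hxy => ?_, ?_⟩
      · rw [hupd x hx, hupd y hy] at hxy
        exact hφ hx hy hxy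
      · rintro ⟨u, hu, hcu⟩
        rw [Function.update_self, hupd u hu] at hcu
        exact hc (hcu ▸ Finset.mem_image_of_mem _ hu)

lemma IsRotation.rotate {V : Type*} {a b c x y z : V} (h : IsRotation a b c x y z) :
    IsRotation a b c y z x := by
  unfold IsRotation at *
  tauto

lemma exists_flipEdge_of_not_edge {V : Type*} {t : V → V → V → Prop} {x y z w a b c : V}
    (ht : t a b c) (h₁ : ¬ (a = x ∧ b = y)) (h₂ : ¬ (a = y ∧ b = x)) :
    ∃ c', flipEdge t x y z w a b c' := by
  by_cases h₃ : IsRotation x y z a b c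
  · rcases h₃ with ⟨rfl, rfl, rfl⟩ | ⟨rfl, rfl, rfl⟩ | ⟨rfl, rfl, rfl⟩
    · exact absurd ⟨rfl, rfl⟩ h₁
    · exact ⟨w, Or.inr (Or.inr (by simp [IsRotation]))⟩
    · exact ⟨w, Or.inr (Or.inl (by simp [IsRotation]))⟩
  by_cases h₄ : IsRotation y x w a b c
  · rcases h₄ with ⟨rfl, rfl, rfl⟩ | ⟨rfl, rfl, rfl⟩ | ⟨rfl, rfl, rfl⟩
    · exact absurd ⟨rfl, rfl⟩ h₂
    · exact ⟨z, Or.inr (Or.inl (by simp [IsRotation]))⟩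
    · exact ⟨z, Or.inr (Or.inr (by simp [IsRotation]))⟩
  exact ⟨c, Or.inl ⟨ht, h₃, h₄⟩⟩

namespace IsTriangulatedSphere

variable {V : Type*} [Fintype V] {S : Finset V} {t : V → V → V → Prop}

section Flip

variable {x y z w : V}

lemma flip_dart (h : IsTriangulatedSphere S t) (hz : t x y z) (hw : t y x w)
    {a b c : V} (ht : flipEdge t x y z w a b c) :
    (∃ c', t a b c') ∧ ¬ (a = x ∧ b = y) ∧ ¬ (a = y ∧ b = x) ∨ (a = z ∧ b = w) ∨
      (a = w ∧ b = z) := by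
  have hyz := h.cyc hz
  have hzx := h.cyc hyz
  have hxw := h.cyc hw
  have hwy := h.cyc hxw
  have n₁ := h.ne hz
  have n₂ := h.ne hyz
  have n₃ := h.ne hzx
  have n₄ := h.ne hxw
  have n₅ := h.ne hwy
  rcases ht with ⟨ht, h₁, h₂⟩ | (⟨rfl, rfl, rfl⟩ | ⟨rfl, rfl, rfl⟩ | ⟨rfl, rfl, rfl⟩) |
    (⟨rfl, rfl, rfl⟩ | ⟨rfl, rfl, rfl⟩ | ⟨rfl, rfl, rfl⟩)
  · refine Or.inl ⟨⟨c, ht⟩, ?_, ?_⟩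
    · rintro ⟨rfl, rfl⟩
      exact h₁ (Or.inl ⟨rfl, rfl, h.uniq ht hz⟩)
    · rintro ⟨rfl, rfl⟩
      exact h₂ (Or.inl ⟨rfl, rfl, h.uniq ht hw⟩)
  all_goals grind

lemma flip_cyc (h : IsTriangulatedSphere S t) {a b c : V} (ht : flipEdge t x y z w a b c) :
    flipEdge t x y z w b c a := by
  rcases ht with ⟨ht, h₁, h₂⟩ | ht | ht
  · exact Or.inl ⟨h.cyc ht, fun hh => h₁ hh.rotate.rotate, fun hh => h₂ hh.rotate.rotate⟩
  · exact Or.inr (Or.inl ht.rotate)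
  · exact Or.inr (Or.inr ht.rotate)

theorem flip (h : IsTriangulatedSphere S t) (hz : t x y z) (hw : t y x w)
    (hzw : z ≠ w) (hadj : ∀ u, ¬ t z w u) : IsTriangulatedSphere S (flipEdge t x y z w) := by
  have hyz := h.cyc hz
  have hzx := h.cyc hyz
  have hxw := h.cyc hw
  have hwy := h.cyc hxw
  have n₁ := h.ne hz
  have n₂ := h.ne hyz
  have n₃ := h.ne hzx
  have n₄ := h.ne hxw
  have n₅ := h.ne hwy
  have hadj' : ∀ u, ¬ t w z u := fun u hu => by
    obtain ⟨_, h'⟩ := h.symm hu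
    exact hadj _ h'
  have new₁ : flipEdge t x y z w z x w := Or.inr (Or.inl (by simp [IsRotation]))
  have new₂ : flipEdge t x y z w x w z := Or.inr (Or.inl (by simp [IsRotation]))
  have new₃ : flipEdge t x y z w w z x := Or.inr (Or.inl (by simp [IsRotation]))
  have new₄ : flipEdge t x y z w w y z := Or.inr (Or.inr (by simp [IsRotation]))
  have new₅ : flipEdge t x y z w y z w := Or.inr (Or.inr (by simp [IsRotation]))
  have new₆ : flipEdge t x y z w z w y := Or.inr (Or.inr (by simp [IsRotation]))
  have old : ∀ a b c, t a b c → flipEdge t x y z w a b c ∨ IsRotation x y z a b c ∨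
      IsRotation y x w a b c := fun a b c ht => by
    by_cases h₁ : IsRotation x y z a b c
    · exact Or.inr (Or.inl h₁)
    by_cases h₂ : IsRotation y x w a b c
    · exact Or.inr (Or.inr h₂)
    exact Or.inl (Or.inl ⟨ht, h₁, h₂⟩)
  refine ⟨?_, ?_, ?_, ?_, ?_, ?_, ?_, ?_, ?_⟩
  · exact fun ht => h.flip_cyc ht
  · intro a b c ht
    have := @h.ne
    rcases h.flip_dart hz hw ht with ⟨⟨_, h₁⟩, -⟩ | ⟨rfl, rfl⟩ | ⟨rfl, rfl⟩
    · exact h.ne h₁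
    · exact hzw
    · exact hzw.symm
  · have hu := @h.uniq
    rintro a b c d (⟨h₁, h₂, h₃⟩ | h₁ | h₁) (⟨h₄, h₅, h₆⟩ | h₄ | h₄)
    · exact hu h₁ h₄
    all_goals clear new₁ new₂ new₃ new₄ new₅ new₆ old
    all_goals unfold IsRotation at *
    · rcases h₄ with ⟨rfl, rfl, rfl⟩ | ⟨rfl, rfl, rfl⟩ | ⟨rfl, rfl, rfl⟩ <;> grind
    · rcases h₄ with ⟨rfl, rfl, rfl⟩ | ⟨rfl, rfl, rfl⟩ | ⟨rfl, rfl, rfl⟩ <;> grind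
    · rcases h₁ with ⟨rfl, rfl, rfl⟩ | ⟨rfl, rfl, rfl⟩ | ⟨rfl, rfl, rfl⟩ <;> grind
    · rcases h₁ with ⟨rfl, rfl, rfl⟩ | ⟨rfl, rfl, rfl⟩ | ⟨rfl, rfl, rfl⟩ <;> grind
    · rcases h₁ with ⟨rfl, rfl, rfl⟩ | ⟨rfl, rfl, rfl⟩ | ⟨rfl, rfl, rfl⟩ <;> grind
    · rcases h₁ with ⟨rfl, rfl, rfl⟩ | ⟨rfl, rfl, rfl⟩ | ⟨rfl, rfl, rfl⟩ <;> grind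
    · rcases h₁ with ⟨rfl, rfl, rfl⟩ | ⟨rfl, rfl, rfl⟩ | ⟨rfl, rfl, rfl⟩ <;> grind
    · rcases h₁ with ⟨rfl, rfl, rfl⟩ | ⟨rfl, rfl, rfl⟩ | ⟨rfl, rfl, rfl⟩ <;> grind
  · intro a b c ht
    rcases h.flip_dart hz hw ht with ⟨⟨_, h₁⟩, h₂, h₃⟩ | ⟨rfl, rfl⟩ | ⟨rfl, rfl⟩
    · obtain ⟨_, h₄⟩ := h.symm h₁
      exact exists_flipEdge_of_not_edge h₄ (by tauto) (by tauto)
    · exact ⟨_, new₃⟩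
    · exact ⟨_, new₆⟩
  · intro a
    constructor
    · intro ha
      obtain ⟨b, c, ht⟩ := (h.mem_iff a).1 ha
      rcases old a b c ht with h₁ | (⟨rfl, rfl, rfl⟩ | ⟨rfl, rfl, rfl⟩ | ⟨rfl, rfl, rfl⟩) |
        (⟨rfl, rfl, rfl⟩ | ⟨rfl, rfl, rfl⟩ | ⟨rfl, rfl, rfl⟩)
      exacts [⟨_, _, h₁⟩, ⟨_, _, new₂⟩, ⟨_, _, new₅⟩, ⟨_, _, new₁⟩, ⟨_, _, new₅⟩, ⟨_, _, new₂⟩,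
        ⟨_, _, new₄⟩]
    · rintro ⟨b, c, ht⟩
      rw [h.mem_iff]
      rcases h.flip_dart hz hw ht with ⟨⟨_, h₁⟩, -⟩ | ⟨rfl, rfl⟩ | ⟨rfl, rfl⟩
      exacts [⟨_, _, h₁⟩, ⟨_, _, hzx⟩, ⟨_, _, hwy⟩]
  · classical
    intro v p hp a b a' b' ha hb hpa
    let q : V → Prop := fun c => if (v = x ∧ c = y) ∨ (v = y ∧ c = x) then p z else p c
    have hq : ∀ c, ¬ (v = x ∧ c = y) → ¬ (v = y ∧ c = x) → (q c ↔ p c) := fun c h₁ h₂ => by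
      simp [q, h₁, h₂]
    have hsource : ∀ c c', flipEdge t x y z w v c c' → ∃ d d', t v d d' ∧ (q d ↔ p c) := by
      intro c c' hc
      rcases h.flip_dart hz hw hc with ⟨⟨d', h₁⟩, h₂, h₃⟩ | ⟨rfl, rfl⟩ | ⟨rfl, rfl⟩
      · exact ⟨c, d', h₁, hq c h₂ h₃⟩
      · refine ⟨x, y, hzx, ?_⟩
        rw [hq x (by tauto) (by tauto)]
        exact hp _ _ new₁
      · refine ⟨y, x, hwy, ?_⟩
        rw [hq y (by tauto) (by tauto)]
        exact hp _ _ new₄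
    obtain ⟨c, c', hc, hca⟩ := hsource a a' ha
    obtain ⟨d, d', hd, hdb⟩ := hsource b b' hb
    refine hdb.1 (h.link v q (fun e f hef => ?_) c d c' d' hc hd (hca.2 hpa))
    rcases old v e f hef with h₁ | (⟨rfl, rfl, rfl⟩ | ⟨rfl, rfl, rfl⟩ | ⟨rfl, rfl, rfl⟩) |
      (⟨rfl, rfl, rfl⟩ | ⟨rfl, rfl, rfl⟩ | ⟨rfl, rfl, rfl⟩)
    · have h₂ := h.flip_dart hz hw h₁
      have h₃ := h.flip_dart hz hw (h.flip_cyc (h.flip_cyc h₁))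
      rw [hq e (by grind) (by grind), hq f (by grind) (by grind)]
      exact hp _ _ h₁
    · grind
    · grind
    · have := hp _ _ new₁
      have := hp _ _ new₆
      grind
    · have := hp _ _ new₅
      grind
    · have := hp _ _ new₂
      grind
    · have := hp _ _ new₄
      have := hp _ _ new₃
      grind
  · intro p hp a ha b hb
    refine h.conn p (fun a b c ht => ?_) a ha b hb
    have e₁ := hp _ _ _ new₁
    have e₂ := hp _ _ _ new₅
    by_cases h₁ : a = x ∧ b = y
    · rw [h₁.1, h₁.2, ← e₁, e₂]
    by_cases h₂ : a = y ∧ b = x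
    · rw [h₂.1, h₂.2, ← e₁, e₂]
    obtain ⟨_, h₃⟩ := exists_flipEdge_of_not_edge ht h₁ h₂
    exact hp _ _ _ h₃
  · classical
    intro f hf hclosed
    let f' : V → V → ZMod 2 := fun a b =>
      if (a = x ∧ b = y) ∨ (a = y ∧ b = x) then f x z + f z y else f a b
    have hf' : ∀ a b, ¬ (a = x ∧ b = y) → ¬ (a = y ∧ b = x) → f' a b = f a b :=
      fun a b h₁ h₂ => by simp [f', h₁, h₂]
    have hxy : f' x y = f x z + f z y := by simp [f']
    have hyx : f' y x = f x z + f z y := by simp [f']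
    have hsymm : ∀ a b, f' a b = f' b a := fun a b => by
      simp only [f', hf a b]
      congr 1
      grind
    have c₁ := hclosed _ _ _ new₁
    have c₂ := hclosed _ _ _ new₄
    have s₁ : f' x y + f' y z + f' z x = 0 := by
      rw [hxy, hf' y z (by grind) (by grind), hf' z x (by grind) (by grind), hf z x, hf z y]
      linear_combination CharTwo.add_self_eq_zero (f x z) + CharTwo.add_self_eq_zero (f y z)
    have s₂ : f' y x + f' x w + f' w y = 0 := by
      rw [hyx, hf' x w (by grind) (by grind), hf' w y (by grind) (by grind), hf x z, hf z y]
      rw [hf w z] at c₁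
      linear_combination c₁ + c₂ - CharTwo.add_self_eq_zero (f z w)
    obtain ⟨g, hg⟩ := h.exact f' hsymm (fun a b c ht => by
      rcases old a b c ht with h₁ | (⟨rfl, rfl, rfl⟩ | ⟨rfl, rfl, rfl⟩ | ⟨rfl, rfl, rfl⟩) |
        (⟨rfl, rfl, rfl⟩ | ⟨rfl, rfl, rfl⟩ | ⟨rfl, rfl, rfl⟩)
      · have d₁ := h.flip_dart hz hw h₁
        have d₂ := h.flip_dart hz hw (h.flip_cyc h₁)
        have d₃ := h.flip_dart hz hw (h.flip_cyc (h.flip_cyc h₁))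
        rw [hf' a b (by grind) (by grind), hf' b c (by grind) (by grind),
          hf' c a (by grind) (by grind)]
        exact hclosed _ _ _ h₁
      · exact s₁
      · linear_combination s₁
      · linear_combination s₁
      · exact s₂
      · linear_combination s₂
      · linear_combination s₂)
    have hzw' : f z w = g z + g w := by
      have e₁ := hg _ _ _ hzx
      have e₂ := hg _ _ _ hxw
      rw [hf' z x (by grind) (by grind)] at e₁
      rw [hf' x w (by grind) (by grind)] at e₂
      rw [hf w z] at c₁
      linear_combination c₁ - e₁ - e₂ - CharTwo.add_self_eq_zero (g x) -
        CharTwo.add_self_eq_zero (g z) - CharTwo.add_self_eq_zero (g w)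
    refine ⟨g, fun a b c ht => ?_⟩
    rcases h.flip_dart hz hw ht with ⟨⟨_, h₁⟩, h₂, h₃⟩ | ⟨rfl, rfl⟩ | ⟨rfl, rfl⟩
    · rw [← hf' a b h₂ h₃]
      exact hg _ _ _ h₁
    · exact hzw'
    · rw [hf a b, hzw', add_comm]
  · classical
    refine le_trans (Nat.add_le_add_right (Nat.card_le_card_of_injective
      (β := {e : V × V // ∃ z, t e.1 e.2 z}) (fun e => ⟨
        if e.1 = (z, w) then (x, y) else if e.1 = (w, z) then (y, x) else e.1, by
          obtain ⟨⟨a, b⟩, c, hc⟩ := e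
          rcases h.flip_dart hz hw hc with ⟨⟨d, h₁⟩, h₂, h₃⟩ | ⟨rfl, rfl⟩ | ⟨rfl, rfl⟩ <;>
            grind⟩) ?_) 12) h.count
    · rintro ⟨⟨a, b⟩, c, hc⟩ ⟨⟨a', b'⟩, c', hc'⟩ heq
      have d₁ := h.flip_dart hz hw hc
      have d₂ := h.flip_dart hz hw hc'
      simp only [Subtype.mk.injEq] at heq ⊢
      clear old new₁ new₂ new₃ new₄ new₅ new₆ hc hc'
      grind

end Flip

section Remove

variable {v a b c : V}

lemma link_three (h : IsTriangulatedSphere S t) (hab : t v a b) (hbc : t v b c) (hca : t v c a)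
    {x y : V} (ht : t v x y) : x = a ∨ x = b ∨ x = c := by
  refine h.link v (fun x => x = a ∨ x = b ∨ x = c) (fun x y hxy => ?_) a x b y hab ht (Or.inl rfl)
  have := @h.uniq
  have := @h.cyc
  grind

lemma remove_dart (h : IsTriangulatedSphere S t) (hab : t v a b) (hbc : t v b c) (hca : t v c a)
    {x y z : V} (ht : removeVertex t v a b c x y z) : (∃ z', t x y z') ∧ x ≠ v ∧ y ≠ v := by
  have n₁ := h.ne hab
  have n₂ := h.ne hbc
  have n₃ := h.ne hca
  rcases ht with ⟨ht, h₁, h₂, h₃⟩ | ⟨rfl, rfl, rfl⟩ | ⟨rfl, rfl, rfl⟩ | ⟨rfl, rfl, rfl⟩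
  exacts [⟨⟨_, ht⟩, h₁, h₂⟩, ⟨⟨_, h.cyc hab⟩, n₁.symm, n₂.symm⟩,
    ⟨⟨_, h.cyc hbc⟩, n₂.symm, n₃.symm⟩, ⟨⟨_, h.cyc hca⟩, n₃.symm, n₁.symm⟩]

lemma remove_keep (h : IsTriangulatedSphere S t) (hab : t v a b) (hbc : t v b c) (hca : t v c a)
    {x y z : V} (ht : t x y z) (hx : x ≠ v) (hy : y ≠ v) : ∃ z', removeVertex t v a b c x y z' := by
  by_cases hz : z = v
  · subst hz
    have h₁ := h.cyc (h.cyc ht)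
    have := @h.uniq
    rcases h.link_three hab hbc hca h₁ with rfl | rfl | rfl
    · obtain rfl := h.uniq h₁ hab
      exact ⟨c, Or.inr (Or.inl ⟨rfl, rfl, rfl⟩)⟩
    · obtain rfl := h.uniq h₁ hbc
      exact ⟨a, Or.inr (Or.inr (Or.inl ⟨rfl, rfl, rfl⟩))⟩
    · obtain rfl := h.uniq h₁ hca
      exact ⟨b, Or.inr (Or.inr (Or.inr ⟨rfl, rfl, rfl⟩))⟩
  · exact ⟨z, Or.inl ⟨ht, hx, hy, hz⟩⟩

theorem remove [DecidableEq V] (h : IsTriangulatedSphere S t) (hab : t v a b) (hbc : t v b c)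
    (hca : t v c a) : IsTriangulatedSphere (S.erase v) (removeVertex t v a b c) := by
  have n₁ := h.ne hab
  have n₂ := h.ne hbc
  have n₃ := h.ne hca
  have hab' := h.cyc hab
  have hbc' := h.cyc hbc
  have hca' := h.cyc hca
  have hab'' := h.cyc hab'
  have hbc'' := h.cyc hbc'
  have hca'' := h.cyc hca'
  have m₁ := h.ne hab'
  have m₂ := h.ne hbc'
  have m₃ := h.ne hca'
  have new₁ : removeVertex t v a b c a b c := Or.inr (Or.inl ⟨rfl, rfl, rfl⟩)
  have new₂ : removeVertex t v a b c b c a := Or.inr (Or.inr (Or.inl ⟨rfl, rfl, rfl⟩))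
  have new₃ : removeVertex t v a b c c a b := Or.inr (Or.inr (Or.inr ⟨rfl, rfl, rfl⟩))
  have hN : ∀ {x y}, t v x y → x = a ∨ x = b ∨ x = c := fun ht => h.link_three hab hbc hca ht
  refine ⟨?_, ?_, ?_, ?_, ?_, ?_, ?_, ?_, ?_⟩
  · rintro x y z (⟨ht, h₁, h₂, h₃⟩ | ht)
    · exact Or.inl ⟨h.cyc ht, h₂, h₃, h₁⟩
    · exact Or.inr ht.rotate
  · intro x y z ht
    obtain ⟨⟨_, h₁⟩, -⟩ := h.remove_dart hab hbc hca ht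
    exact h.ne h₁
  · have hu := @h.uniq
    rintro x y z w (⟨h₁, h₂, h₃, h₄⟩ | h₁) (⟨h₅, h₆, h₇, h₈⟩ | h₅)
    · exact hu h₁ h₅
    all_goals clear new₁ new₂ new₃
    all_goals unfold IsRotation at *
    all_goals grind
  · intro x y z ht
    obtain ⟨⟨_, h₁⟩, hx, hy⟩ := h.remove_dart hab hbc hca ht
    obtain ⟨_, h₂⟩ := h.symm h₁
    exact h.remove_keep hab hbc hca h₂ hy hx
  · intro x
    rw [Finset.mem_erase, h.mem_iff]
    constructor
    · rintro ⟨hx, y, z, ht⟩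
      by_cases hy : y = v
      · subst hy
        obtain ⟨_, h₁⟩ := h.symm ht
        rcases hN h₁ with rfl | rfl | rfl
        exacts [⟨_, _, new₁⟩, ⟨_, _, new₂⟩, ⟨_, _, new₃⟩]
      · exact ⟨y, h.remove_keep hab hbc hca ht hx hy⟩
    · rintro ⟨y, z, ht⟩
      obtain ⟨h₁, hx, -⟩ := h.remove_dart hab hbc hca ht
      exact ⟨hx, y, h₁⟩
  · intro u p hp x y x' y' hx hy hpx
    obtain ⟨⟨x'', h₁⟩, h₂, h₃⟩ := h.remove_dart hab hbc hca hx
    obtain ⟨⟨y'', h₄⟩, -, h₅⟩ := h.remove_dart hab hbc hca hy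
    let q : V → Prop := fun z =>
      if z = v then (if u = a then p b else if u = b then p c else p a) else p z
    have hq : ∀ z, z ≠ v → (q z ↔ p z) := fun z hz => by simp [q, hz]
    refine (hq y h₅).1 (h.link u q (fun e f hef => ?_) x y x'' y'' h₁ h₄ ((hq x h₃).2 hpx))
    by_cases hev : e = v
    · subst hev
      have hfe := h.cyc hef
      have hff := h.ne hfe
      rw [hq f hff.symm]
      have hu := @h.uniq
      rcases h.link_three hab hbc hca hfe with rfl | rfl | rfl
      · obtain rfl := hu hfe hab
        have := hp _ _ new₂
        grind
      · obtain rfl := hu hfe hbc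
        have := hp _ _ new₃
        grind
      · obtain rfl := hu hfe hca
        have := hp _ _ new₁
        grind
    by_cases hfv : f = v
    · subst hfv
      have hfe := h.cyc (h.cyc hef)
      rw [hq e hev]
      have hu := @h.uniq
      rcases h.link_three hab hbc hca hfe with rfl | rfl | rfl <;> grind
    rw [hq e hev, hq f hfv]
    exact hp _ _ (Or.inl ⟨hef, h₂, hev, hfv⟩)
  · intro p hp x hx y hy hpx
    have e₁ := hp _ _ _ new₁
    have e₂ := hp _ _ _ new₂
    let q : V → Prop := fun z => if z = v then p a else p z
    have hq : ∀ z, z ≠ v → (q z ↔ p z) := fun z hz => by simp [q, hz]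
    have hqv : q v ↔ p a := by simp [q]
    rw [Finset.mem_erase] at hx hy
    refine (hq y hy.1).1 (h.conn q (fun e f g ht => ?_) x hx.2 y hy.2 ((hq x hx.1).2 hpx))
    by_cases hev : e = v
    · subst hev
      rw [hqv, hq f (h.ne ht).symm]
      rcases hN ht with rfl | rfl | rfl <;> grind
    by_cases hfv : f = v
    · subst hfv
      obtain ⟨_, ht'⟩ := h.symm ht
      rw [hqv, hq e hev]
      rcases hN ht' with rfl | rfl | rfl <;> grind
    obtain ⟨_, ht'⟩ := h.remove_keep hab hbc hca ht hev hfv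
    rw [hq e hev, hq f hfv]
    exact hp _ _ _ ht'
  · intro f hf hclosed
    let f' : V → V → ZMod 2 := fun x y =>
      if x = v then (if y = a then 0 else f a y) else if y = v then (if x = a then 0 else f a x)
      else f x y
    have hf' : ∀ x y, x ≠ v → y ≠ v → f' x y = f x y := fun x y h₁ h₂ => by simp [f', h₁, h₂]
    have hsymm : ∀ x y, f' x y = f' y x := fun x y => by
      simp only [f', hf x y]
      grind
    have hva : f' v a = 0 := by simp [f']
    have hvb : f' v b = f a b := by simp [f', m₁.symm]
    have hvc : f' v c = f a c := by simp [f', m₃]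
    have c₁ := hclosed _ _ _ new₁
    have s₁ : f' v a + f' a b + f' b v = 0 := by
      rw [hva, hsymm b, hvb, hf' a b n₁.symm n₂.symm, zero_add, CharTwo.add_self_eq_zero]
    have s₂ : f' v b + f' b c + f' c v = 0 := by
      rw [hvb, hsymm c, hvc, hf' b c n₂.symm n₃.symm, hf a c, c₁]
    have s₃ : f' v c + f' c a + f' a v = 0 := by
      rw [hvc, hsymm a, hva, hf' c a n₃.symm n₁.symm, hf a c, add_zero, CharTwo.add_self_eq_zero]
    have hcl : ∀ y z, t v y z → f' v y + f' y z + f' z v = 0 := fun y z ht => by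
      have hu := @h.uniq
      rcases hN ht with rfl | rfl | rfl
      · rwa [hu ht hab]
      · rwa [hu ht hbc]
      · rwa [hu ht hca]
    obtain ⟨g, hg⟩ := h.exact f' hsymm (fun x y z ht => by
      by_cases hx : x = v
      · subst hx
        exact hcl _ _ ht
      by_cases hy : y = v
      · subst hy
        linear_combination hcl _ _ (h.cyc ht)
      by_cases hz : z = v
      · subst hz
        linear_combination hcl _ _ (h.cyc (h.cyc ht))
      rw [hf' x y hx hy, hf' y z hy hz, hf' z x hz hx]
      exact hclosed _ _ _ (Or.inl ⟨ht, hx, hy, hz⟩))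
    refine ⟨g, fun x y z ht => ?_⟩
    obtain ⟨⟨_, h₁⟩, hx, hy⟩ := h.remove_dart hab hbc hca ht
    rw [← hf' x y hx hy]
    exact hg _ _ _ h₁
  · have hv : v ∈ S := (h.mem_iff v).2 ⟨_, _, hab⟩
    have hcard := Finset.card_erase_add_one hv
    have hle : Nat.card ({e : V × V // ∃ z, removeVertex t v a b c e.1 e.2 z} ⊕ Fin 6) ≤
        Nat.card {e : V × V // ∃ z, t e.1 e.2 z} := by
      refine Nat.card_le_card_of_injective (Sum.elim (fun e => ⟨e.1,
        (h.remove_dart hab hbc hca e.2.choose_spec).1⟩) ![⟨(v, a), _, hab⟩, ⟨(v, b), _, hbc⟩,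
          ⟨(v, c), _, hca⟩, ⟨(a, v), _, hca''⟩, ⟨(b, v), _, hab''⟩, ⟨(c, v), _, hbc''⟩]) ?_
      refine Function.Injective.sumElim ?_ ?_ ?_
      · rintro ⟨e, he⟩ ⟨f, hf⟩ heq
        simpa using heq
      · intro i j hij
        fin_cases i <;> fin_cases j <;> simp_all
      · rintro ⟨⟨x, y⟩, z, hz⟩ j
        have := h.remove_dart hab hbc hca hz
        fin_cases j <;> simp <;> grind
    rw [Nat.card_sum, Nat.card_fin] at hle
    have := h.count
    omega

end Remove

section Separation

/-- The `ZMod 2`-chain of the boundary of the triangle `x y z`. -/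
def triangleBoundary [DecidableEq V] (x y z : V) : V × V → ZMod 2 :=
  Pi.single (x, y) 1 + Pi.single (y, x) 1 + (Pi.single (y, z) 1 + Pi.single (z, y) 1) +
    (Pi.single (z, x) 1 + Pi.single (x, z) 1)

/-- Every triangle of edges bounds a set of faces modulo two. -/
lemma exists_faces_of_triangle [DecidableEq V] (h : IsTriangulatedSphere S t) {a b c a' b' c' : V}
    (hab : t a b c') (hbc : t b c a') (hca : t c a b') :
    ∃ k : V → V → V → ZMod 2, (∀ x y z, t x y z → k x y z = k y z x) ∧
      ∀ x y z w, t x y z → t y x w → k x y z + k y x w = triangleBoundary a b c (x, y) := by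
  let W : Submodule (ZMod 2) (V × V → ZMod 2) :=
    Submodule.span _ {u | ∃ x y z, t x y z ∧ u = triangleBoundary x y z}
  have hmem : triangleBoundary a b c ∈ W := by
    by_contra hnot
    obtain ⟨ψ, hψ, hW⟩ := Submodule.exists_le_ker_of_notMem hnot
    let f : V → V → ZMod 2 := fun x y => ψ (Pi.single (x, y) 1) + ψ (Pi.single (y, x) 1)
    have hf : ∀ x y z, ψ (triangleBoundary x y z) = f x y + f y z + f z x := fun x y z => by
      simp only [f, ← map_add]
      rfl
    obtain ⟨g, hg⟩ := h.exact f (fun x y => add_comm _ _) (fun x y z ht => by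
      rw [← hf]
      exact hW (Submodule.subset_span ⟨x, y, z, ht, rfl⟩))
    apply hψ
    rw [hf, hg _ _ _ hab, hg _ _ _ hbc, hg _ _ _ hca]
    linear_combination CharTwo.add_self_eq_zero (g a) + CharTwo.add_self_eq_zero (g b) +
      CharTwo.add_self_eq_zero (g c)
  generalize triangleBoundary a b c = u at hmem
  induction hmem using Submodule.span_induction with
  | zero => exact ⟨fun _ _ _ => 0, by simp, by simp⟩
  | add u₁ u₂ _ _ h₁ h₂ =>
    obtain ⟨k₁, hc₁, hk₁⟩ := h₁
    obtain ⟨k₂, hc₂, hk₂⟩ := h₂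
    refine ⟨fun x y z => k₁ x y z + k₂ x y z, fun x y z ht => ?_, fun x y z w hz hw => ?_⟩
    · simp only [hc₁ _ _ _ ht, hc₂ _ _ _ ht]
    · rw [Pi.add_apply, ← hk₁ _ _ _ _ hz hw, ← hk₂ _ _ _ _ hz hw]
      ring
  | smul r u _ h₁ =>
    obtain ⟨k₁, hc₁, hk₁⟩ := h₁
    refine ⟨fun x y z => r * k₁ x y z, fun x y z ht => ?_, fun x y z w hz hw => ?_⟩
    · simp only [hc₁ _ _ _ ht]
    · rw [Pi.smul_apply, smul_eq_mul, ← hk₁ _ _ _ _ hz hw]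
      ring
  | mem u hu =>
    obtain ⟨p, q, r, ht, rfl⟩ := hu
    classical
    refine ⟨fun x y z => if IsRotation p q r x y z then 1 else 0, fun x y z _ => ?_,
      fun x y z w hz hw => ?_⟩
    · exact if_congr ⟨fun hh => hh.rotate, fun hh => hh.rotate.rotate⟩ rfl rfl
    · have ht' := h.cyc ht
      have ht'' := h.cyc ht'
      have n₁ := h.ne ht
      have n₂ := h.ne ht'
      have n₃ := h.ne ht''
      have hu := @h.uniq
      have e₁ : IsRotation p q r x y z ↔ (x = p ∧ y = q) ∨ (x = q ∧ y = r) ∨ (x = r ∧ y = p) := by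
        unfold IsRotation
        grind
      have e₂ : IsRotation p q r y x w ↔ (y = p ∧ x = q) ∨ (y = q ∧ x = r) ∨ (y = r ∧ x = p) := by
        unfold IsRotation
        grind
      simp only [e₁, e₂, triangleBoundary, Pi.add_apply, Pi.single_apply, Prod.mk.injEq]
      clear e₁ e₂ hu ht ht' ht'' hz hw
      split_ifs <;> first | rfl | grind

/-- A triangle through `v` separates the neighbors of `v` on its two sides. -/
theorem not_adj_of_crossing (h : IsTriangulatedSphere S t) {v a b c d : V} (hab : t v a b)
    (hbc : t v b c) (hac : ∃ z, t a c z) (hd : ∃ z, t v d z) (hda : d ≠ a) (hdc : d ≠ c) :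
    ¬ ∃ z, t b d z := by
  classical
  rintro ⟨e, hbd⟩
  obtain ⟨_, hac⟩ := hac
  obtain ⟨d', hd⟩ := hd
  have hca : ∃ z, t c a z := h.symm hac
  obtain ⟨_, hcv⟩ : ∃ z, t c v z := ⟨_, h.cyc (h.cyc hbc)⟩
  obtain ⟨_, hvc⟩ := h.symm hcv
  obtain ⟨k, hk, hkb⟩ := h.exists_faces_of_triangle hab hac hcv
  have hu := @h.uniq
  have n₁ := h.ne hab
  have n₂ := h.ne hbc
  have n₃ := h.ne hd
  have n₄ := h.ne hbd
  have n₅ := h.ne (h.cyc hab)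
  have n₆ := h.ne (h.cyc hbc)
  have n₇ := h.ne hvc
  have n₈ := h.ne hac
  have hflip : ∀ u x y z, t u x y → t u y z →
      k u y z + k u x y = triangleBoundary v a c (u, y) := by
    intro u x y z hx hy
    rw [hk u x y hx, hk x y u (h.cyc hx)]
    exact hkb _ _ _ _ hy (h.cyc (h.cyc hx))
  have hconst : ∀ u, u ≠ v → u ≠ a → u ≠ c → ∀ x y x' y', t u x x' → t u y y' →
      k u x x' = k u y y' := by
    intro u h₁ h₂ h₃ x y x' y' hx hy
    refine h.link u (fun y => ∀ y', t u y y' → k u x x' = k u y y') (fun p q hpq => ?_) x y x' y' hx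
      hy (fun z hz => by rw [hu hz hx]) _ hy
    have key : ∀ q', t u q q' → k u q q' = k u p q := fun q' hq' => by
      rw [← sub_eq_zero, CharTwo.sub_eq_add, hflip _ _ _ _ hpq hq']
      simp [triangleBoundary, h₁, h₂, h₃]
    constructor
    · intro hp q' hq'
      rw [hp q hpq, key q' hq']
    · intro hq p' hp'
      obtain ⟨q', hqu⟩ := h.symm (h.cyc (h.cyc hpq))
      rw [hu hp' hpq, hq q' hqu, key q' hqu]
  have hb : k v b c = k v a b := by
    rw [← sub_eq_zero, CharTwo.sub_eq_add, hflip _ _ _ _ hab hbc]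
    simp [triangleBoundary, n₁.symm, n₅.symm, n₆, n₂]
  have hpred : ∀ {y y' z}, t v y z → t v y' z → y = y' := fun h₁ h₂ =>
    hu (h.cyc (h.cyc h₁)) (h.cyc (h.cyc h₂))
  have hstep : ∀ y z z', t v y z → t v z z' → z ≠ a → z ≠ c → k v z z' = k v y z :=
    fun y z z' hy hz hza hzc => by
      rw [← sub_eq_zero, CharTwo.sub_eq_add, hflip _ _ _ _ hy hz]
      simp [triangleBoundary, hza, hzc, n₁, n₇]
  have hstep' : ∀ y z z', t v y z → t v z z' → z = a ∨ z = c → k v z z' = k v y z + 1 :=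
    fun y z z' hy hz hzz => by
      have := hflip _ _ _ _ hy hz
      rcases hzz with rfl | rfl <;>
        simp [triangleBoundary, n₁, n₇, n₁.symm, n₇.symm, n₈, n₈.symm] at this <;>
        linear_combination this - CharTwo.add_self_eq_zero (k v y z)
  have hside : ∀ y z, t v y z → y = a ∨ y = b ∨ k v y z = k v a b + 1 := by
    intro y z hyz
    have := h.link v (fun y => y = a ∨ y = b ∨ ∀ z, t v y z → k v y z = k v a b + 1)
      (fun p q hpq => ?_) a y b z hab hyz (Or.inl rfl)
    · exact this.imp_right (fun h => h.imp_right (fun h => h z hyz))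
    obtain ⟨q', hq⟩ := h.symm (h.cyc (h.cyc hpq))
    by_cases hqa : q = a
    · subst hqa
      refine iff_of_true (Or.inr (Or.inr fun z hz => ?_)) (Or.inl rfl)
      rw [hu hz hpq, hstep' _ _ _ hpq hab (Or.inl rfl), add_assoc, CharTwo.add_self_eq_zero,
        add_zero]
    by_cases hqb : q = b
    · subst hqb
      exact iff_of_true (Or.inl (hpred hpq hab)) (Or.inr (Or.inl rfl))
    have hpa : p ≠ a := by
      rintro rfl
      exact hqb (hu hpq hab)
    by_cases hqc : q = c
    · subst hqc
      refine iff_of_true (Or.inr (Or.inl (hpred hpq hbc))) (Or.inr (Or.inr fun z hz => ?_))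
      rw [hstep' _ _ _ hbc hz (Or.inr rfl), hb]
    have hpb : p ≠ b := by
      rintro rfl
      exact hqc (hu hpq hbc)
    simp only [hpa, hpb, hqa, hqb, false_or]
    refine ⟨fun hp z hz => ?_, fun hp z hz => ?_⟩
    · rw [hstep _ _ _ hpq hz hqa hqc, hp _ hpq]
    · rw [hu hz hpq, ← hstep _ _ _ hpq hq hqa hqc, hp _ hq]
  have hkd := (hside d d' hd).resolve_left hda |>.resolve_left n₄.symm
  have h₁ := hconst b n₂.symm n₅.symm n₆ _ _ _ _ hbd (h.cyc (h.cyc hab))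
  have h₂ := hconst d n₃.symm hda hdc _ _ _ _ (h.cyc hbd) (h.cyc hd)
  rw [← hk _ _ _ hbd, ← hk _ _ _ hd, h₁, ← hk _ _ _ (h.cyc hab), ← hk _ _ _ hab, hkd] at h₂
  simp at h₂

end Separation

section Links

open Classical in
/-- The neighbors of `v`. -/
noncomputable def nbr (t : V → V → V → Prop) (v : V) : Finset V := {y | ∃ z, t v y z}

lemma mem_nbr {v y : V} : y ∈ nbr t v ↔ ∃ z, t v y z := by
  classical
  simp [nbr]

lemma exists_card_nbr_le_five (h : IsTriangulatedSphere S t) : ∃ v ∈ S, (nbr t v).card ≤ 5 := by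
  classical
  by_contra! hS
  have hcard : Nat.card {e : V × V // ∃ z, t e.1 e.2 z} = ∑ v, (nbr t v).card := by
    rw [Nat.card_congr (β := Σ v, nbr t v)
      ⟨fun e => ⟨e.1.1, e.1.2, mem_nbr.2 e.2⟩, fun e => ⟨(e.1, e.2), mem_nbr.1 e.2.2⟩,
        fun _ => rfl, fun _ => rfl⟩]
    simp
  have h₁ : ∑ v ∈ S, 6 ≤ ∑ v ∈ S, (nbr t v).card := Finset.sum_le_sum hS
  have h₂ : ∑ v ∈ S, (nbr t v).card ≤ ∑ v, (nbr t v).card :=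
    Finset.sum_le_sum_of_subset (Finset.subset_univ S)
  have := h.count
  simp only [Finset.sum_const, smul_eq_mul] at h₁
  omega

lemma pred_unique (h : IsTriangulatedSphere S t) {v x y z : V} (hx : t v x z) (hy : t v y z) :
    x = y :=
  h.uniq (h.cyc (h.cyc hx)) (h.cyc (h.cyc hy))

/-- The neighborhood of a vertex of degree at most five is a cycle of length two to five. -/
lemma exists_link_cycle (h : IsTriangulatedSphere S t) {v : V} (hv : v ∈ S)
    (hdeg : (nbr t v).card ≤ 5) :
    (∃ a b, t v a b ∧ t v b a) ∨ (∃ a b c, t v a b ∧ t v b c ∧ t v c a) ∨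
    (∃ a b c d, t v a b ∧ t v b c ∧ t v c d ∧ t v d a ∧ a ≠ c ∧ b ≠ d) ∨
    ∃ a b c d e, t v a b ∧ t v b c ∧ t v c d ∧ t v d e ∧ t v e a ∧ a ≠ c ∧ a ≠ d ∧ b ≠ d ∧
      b ≠ e ∧ c ≠ e := by
  classical
  have hp := @h.pred_unique
  have hnext : ∀ {x y}, t v x y → ∃ z, t v y z := fun hxy => h.symm (h.cyc (h.cyc hxy))
  have hne : ∀ {x y}, t v x y → x ≠ y := fun hxy => h.ne (h.cyc hxy)
  obtain ⟨a, b, hab⟩ := (h.mem_iff v).1 hv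
  obtain ⟨c, hbc⟩ := hnext hab
  obtain ⟨d, hcd⟩ := hnext hbc
  obtain ⟨e, hde⟩ := hnext hcd
  obtain ⟨f, hef⟩ := hnext hde
  obtain ⟨g, hfg⟩ := hnext hef
  by_cases hca : c = a
  · exact Or.inl ⟨a, b, hab, hca ▸ hbc⟩
  by_cases hda : d = a
  · exact Or.inr (Or.inl ⟨a, b, c, hab, hbc, hda ▸ hcd⟩)
  have hdb : d ≠ b := fun hh => hca (hp (hh ▸ hcd) hab)
  by_cases hea : e = a
  · exact Or.inr (Or.inr (Or.inl ⟨a, b, c, d, hab, hbc, hcd, hea ▸ hde, Ne.symm hca, hdb.symm⟩))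
  have heb : e ≠ b := fun hh => hda (hp (hh ▸ hde) hab)
  have hec : e ≠ c := fun hh => hdb (hp (hh ▸ hde) hbc)
  by_cases hfa : f = a
  · exact Or.inr (Or.inr (Or.inr ⟨a, b, c, d, e, hab, hbc, hcd, hde, hfa ▸ hef, Ne.symm hca,
      Ne.symm hda, hdb.symm, heb.symm, hec.symm⟩))
  have hfb : f ≠ b := fun hh => hea (hp (hh ▸ hef) hab)
  have hfc : f ≠ c := fun hh => heb (hp (hh ▸ hef) hbc)
  have hfd : f ≠ d := fun hh => hec (hp (hh ▸ hef) hcd)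
  have hsub : ({a, b, c, d, e, f} : Finset V) ⊆ nbr t v := by
    intro x hx
    simp only [Finset.mem_insert, Finset.mem_singleton] at hx
    rcases hx with rfl | rfl | rfl | rfl | rfl | rfl <;> exact mem_nbr.2 ⟨_, by assumption⟩
  have := Finset.card_le_card hsub
  have n₁ := hne hab
  have n₂ := hne hbc
  have n₃ := hne hcd
  have n₄ := hne hde
  have n₅ := hne hef
  repeat rw [Finset.card_insert_of_notMem (by
    simp only [Finset.mem_insert, Finset.mem_singleton]
    grind)] at this
  rw [Finset.card_singleton] at this
  omega

/-- A predicate closed under the rotation around `v` holds for all or no neighbors. -/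
lemma mem_of_closed (h : IsTriangulatedSphere S t) {v a b y z : V} (p : V → Prop)
    (hp : ∀ x, p x → ∃ y, t v x y ∧ p y) (hp' : ∀ y, p y → ∃ x, t v x y ∧ p x)
    (hab : t v a b) (ha : p a) (hy : t v y z) : p y := by
  refine h.link v p (fun x y hxy => ⟨fun hx => ?_, fun hy => ?_⟩) a y b z hab hy ha
  · obtain ⟨y', hy', hpy⟩ := hp x hx
    rwa [h.uniq hxy hy']
  · obtain ⟨x', hx', hpx⟩ := hp' y hy
    rwa [h.pred_unique hxy hx']

lemma mem_pair (h : IsTriangulatedSphere S t) {v a b y z : V} (hab : t v a b) (hba : t v b a)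
    (hy : t v y z) : y = a ∨ y = b := by
  refine h.mem_of_closed (fun y => y = a ∨ y = b) ?_ ?_ hab (Or.inl rfl) hy <;> grind

lemma mem_four (h : IsTriangulatedSphere S t) {v a b c d y z : V} (hab : t v a b) (hbc : t v b c)
    (hcd : t v c d) (hda : t v d a) (hy : t v y z) : y = a ∨ y = b ∨ y = c ∨ y = d := by
  refine h.mem_of_closed (fun y => y = a ∨ y = b ∨ y = c ∨ y = d) ?_ ?_ hab (Or.inl rfl) hy <;>
    grind

lemma mem_five (h : IsTriangulatedSphere S t) {v a b c d e y z : V} (hab : t v a b)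
    (hbc : t v b c) (hcd : t v c d) (hde : t v d e) (hea : t v e a) (hy : t v y z) :
    y = a ∨ y = b ∨ y = c ∨ y = d ∨ y = e := by
  refine h.mem_of_closed (fun y => y = a ∨ y = b ∨ y = c ∨ y = d ∨ y = e) ?_ ?_ hab (Or.inl rfl)
    hy <;> grind

lemma card_le_three_of_link_pair (h : IsTriangulatedSphere S t) {v a b : V} (hab : t v a b)
    (hba : t v b a) : S.card ≤ 3 := by
  classical
  have hv : v ∈ S := (h.mem_iff v).2 ⟨a, b, hab⟩
  have hsub : S ⊆ {v, a, b} := by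
    intro y hy
    simp only [Finset.mem_insert, Finset.mem_singleton]
    refine h.conn (fun y => y = v ∨ y = a ∨ y = b) (fun x y z hxy => ?_) v hv y hy (Or.inl rfl)
    have key : ∀ x y z, t x y z → (x = v ∨ x = a ∨ x = b) → y = v ∨ y = a ∨ y = b := by
      rintro x y z hxy (rfl | rfl | rfl)
      · exact Or.inr (h.mem_pair hab hba hxy)
      · have := h.mem_pair (h.cyc hab) (h.cyc (h.cyc hba)) hxy
        tauto
      · have := h.mem_pair (h.cyc (h.cyc hab)) (h.cyc hba) hxy
        tauto
    obtain ⟨w, hw⟩ := h.symm hxy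
    exact ⟨key _ _ _ hxy, key _ _ _ hw⟩
  exact (Finset.card_le_card hsub).trans Finset.card_le_three

end Links

section Reduction

/-- `t'` triangulates the sphere with `v` removed, keeping the edges away from `v` and adding edges
only between neighbors of `v`. -/
structure IsReduction [DecidableEq V] (S : Finset V) (t t' : V → V → V → Prop) (v : V) : Prop where
  sphere : IsTriangulatedSphere (S.erase v) t'
  keep : ∀ {x y z}, t x y z → x ≠ v → y ≠ v → ∃ z', t' x y z'
  sub : ∀ {x y z}, t' x y z → (∃ z', t x y z') ∨ ∃ y', t v x y'

variable [DecidableEq V] {v a b c d e : V}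

lemma isReduction_three (h : IsTriangulatedSphere S t) (hab : t v a b) (hbc : t v b c)
    (hca : t v c a) : IsReduction S t (removeVertex t v a b c) v where
  sphere := h.remove hab hbc hca
  keep ht := h.remove_keep hab hbc hca ht
  sub ht := Or.inl (h.remove_dart hab hbc hca ht).1

lemma exists_isReduction_four (h : IsTriangulatedSphere S t) (hab : t v a b) (hbc : t v b c)
    (hcd : t v c d) (hda : t v d a) (hac : a ≠ c) (hadj : ¬ ∃ z, t a c z) :
    ∃ t', IsReduction S t t' v ∧ ∃ z, t' a c z := by
  have hbv := h.cyc (h.cyc hab)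
  have n₁ := h.ne hab
  have n₂ := h.ne hbc
  have n₃ := h.ne hcd
  have n₄ := h.ne hda
  have n₅ := h.ne (h.cyc hab)
  have n₆ := h.ne (h.cyc hbc)
  have n₇ := h.ne (h.cyc hcd)
  have n₈ := h.ne (h.cyc hda)
  have h₁ := h.flip hbc hbv hac.symm (fun u hu => hadj (h.symm hu))
  have hca₁ : flipEdge t v b c a v a c := Or.inr (Or.inl (by simp [IsRotation]))
  have hcd₁ : flipEdge t v b c a v c d := Or.inl ⟨hcd, by unfold IsRotation; grind,
    by unfold IsRotation; grind⟩
  have hda₁ : flipEdge t v b c a v d a := Or.inl ⟨hda, by unfold IsRotation; grind,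
    by unfold IsRotation; grind⟩
  refine ⟨_, ⟨h₁.remove hca₁ hcd₁ hda₁, fun {x y z} ht hx hy => ?_, fun {x y z} ht => ?_⟩,
    h₁.remove_keep hca₁ hcd₁ hda₁ (h₁.cyc hca₁) n₁.symm n₃.symm⟩
  · obtain ⟨z', hz'⟩ := exists_flipEdge_of_not_edge (z := c) (w := a) ht
      (fun hh => hx hh.1) (fun hh => hy hh.2)
    exact h₁.remove_keep hca₁ hcd₁ hda₁ hz' hx hy
  · obtain ⟨⟨z', hz'⟩, -, -⟩ := h₁.remove_dart hca₁ hcd₁ hda₁ ht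
    rcases h.flip_dart hbc hbv hz' with hh | ⟨rfl, rfl⟩ | ⟨rfl, rfl⟩
    exacts [Or.inl hh.1, Or.inr ⟨_, hcd⟩, Or.inr ⟨_, hab⟩]

lemma exists_isReduction_five_of_not_adj (h : IsTriangulatedSphere S t) (hab : t v a b)
    (hbc : t v b c) (hcd : t v c d) (hde : t v d e) (hea : t v e a) (hac : a ≠ c) (had : a ≠ d)
    (hbd : b ≠ d) (hbe : b ≠ e) (hce : c ≠ e)
    (hadj : ¬ ∃ z, t a c z) (hadj' : ¬ ∃ z, t a d z) : ∃ t', IsReduction S t t' v := by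
  have hbv := h.cyc (h.cyc hab)
  have n₁ := h.ne hab
  have n₂ := h.ne hbc
  have n₃ := h.ne hcd
  have n₄ := h.ne hde
  have n₅ := h.ne (h.cyc hab)
  have n₆ := h.ne (h.cyc hbc)
  have n₇ := h.ne (h.cyc hcd)
  have n₈ := h.ne (h.cyc hde)
  have n₉ := h.ne hea
  have h₁ := h.flip hbc hbv hac.symm (fun u hu => hadj (h.symm hu))
  have hca₁ : flipEdge t v b c a v a c := Or.inr (Or.inl (by simp [IsRotation]))
  have hcd₁ : flipEdge t v b c a v c d := Or.inl ⟨hcd, by unfold IsRotation; grind,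
    by unfold IsRotation; grind⟩
  have hde₁ : flipEdge t v b c a v d e := Or.inl ⟨hde, by unfold IsRotation; grind,
    by unfold IsRotation; grind⟩
  have hea₁ : flipEdge t v b c a v e a := Or.inl ⟨hea, by unfold IsRotation; grind,
    by unfold IsRotation; grind⟩
  obtain ⟨t', ht', -⟩ := h₁.exists_isReduction_four hde₁ hea₁ hca₁ hcd₁ had.symm (by
    rintro ⟨z, hz⟩
    rcases h.flip_dart hbc hbv hz with hh | hh | hh
    · obtain ⟨⟨z', hz'⟩, -⟩ := hh
      exact hadj' (h.symm hz')
    · exact n₇ hh.1.symm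
    · exact had hh.1.symm)
  refine ⟨t', ht'.sphere, fun {x y z} ht hx hy => ?_, fun {x y z} ht => ?_⟩
  · obtain ⟨z', hz'⟩ := exists_flipEdge_of_not_edge (z := c) (w := a) ht
      (fun hh => hx hh.1) (fun hh => hy hh.2)
    exact ht'.keep hz' hx hy
  · rcases ht'.sub ht with ⟨z', hz'⟩ | ⟨z', hz'⟩
    · rcases h.flip_dart hbc hbv hz' with hh | ⟨rfl, rfl⟩ | ⟨rfl, rfl⟩
      exacts [Or.inl hh.1, Or.inr ⟨_, hcd⟩, Or.inr ⟨_, hab⟩]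
    · rcases h.flip_dart hbc hbv hz' with hh | hh | hh
      exacts [Or.inr hh.1, absurd hh.1 n₃, absurd hh.1 n₁]

lemma exists_isReduction_five (h : IsTriangulatedSphere S t) (hab : t v a b)
    (hbc : t v b c) (hcd : t v c d) (hde : t v d e) (hea : t v e a) (hac : a ≠ c) (had : a ≠ d)
    (hbd : b ≠ d) (hbe : b ≠ e) (hce : c ≠ e) : ∃ t', IsReduction S t t' v := by
  by_cases h₁ : ∃ z, t a c z
  · exact h.exists_isReduction_five_of_not_adj hbc hcd hde hea hab hbd hbe hce hac.symm had.symm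
      (h.not_adj_of_crossing hab hbc h₁ ⟨_, hde⟩ had.symm (h.ne (h.cyc hcd)).symm)
      (h.not_adj_of_crossing hab hbc h₁ ⟨_, hea⟩ (h.ne (h.cyc hea)) hce.symm)
  by_cases h₂ : ∃ z, t a d z
  · obtain ⟨_, h₂⟩ := h₂
    have h₃ := h.symm h₂
    exact h.exists_isReduction_five_of_not_adj hea hab hbc hcd hde hbe.symm hce.symm hac had hbd
      (h.not_adj_of_crossing hde hea h₃ ⟨_, hbc⟩ hbd (h.ne (h.cyc hab)).symm)
      (h.not_adj_of_crossing hde hea h₃ ⟨_, hcd⟩ (h.ne (h.cyc hcd)) hac.symm)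
  · exact h.exists_isReduction_five_of_not_adj hab hbc hcd hde hea hac had hbd hbe hce h₁ h₂

end Reduction

section Coloring

variable [DecidableEq V]

/-- `φ` is a 3-dynamic coloring of the triangulation `t`. -/
structure IsThreeDynamic (S : Finset V) (t : V → V → V → Prop) (φ : V → ℕ) : Prop where
  proper : ∀ {x y z}, t x y z → φ x ≠ φ y
  three_le : ∀ u ∈ S, 3 ≤ (nbr t u).card → 3 ≤ ((nbr t u).image φ).card

variable {v : V} {t' : V → V → V → Prop} {φ : V → ℕ}

/-- For a neighbor `u` of `v` whose two common neighbors with `v` on the faces at `v u` have the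
same color, it is enough to avoid that color and one more in order that `u` sees three colors. -/
lemma exists_extra_color (h : IsTriangulatedSphere S t) (ht' : IsReduction S t t' v)
    (hφ : ∀ {x y z}, t' x y z → φ x ≠ φ y) :
    ∃ ex : V → ℕ, ∀ p u s, t v p u → t v u s → p ≠ s → ∀ c, c ≠ φ p → c ≠ ex u →
      3 ≤ (insert c (((nbr t u).erase v).image φ)).card := by
  have key : ∀ u, ∃ x, ∀ p s, t v p u → t v u s → p ≠ s → ∀ c, c ≠ φ p → c ≠ x →
      3 ≤ (insert c (((nbr t u).erase v).image φ)).card := by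
    intro u
    by_cases hu : ∃ p s, t v p u ∧ t v u s ∧ p ≠ s
    · obtain ⟨p, s, hpu, hus, hps⟩ := hu
      have hup := h.cyc (h.cyc hpu)
      obtain ⟨q, hq⟩ : ∃ q, t u p q := h.symm (h.cyc hpu)
      have hpv := h.ne hpu
      have huv := h.ne hus
      have hqv : q ≠ v := by
        rintro rfl
        exact hps (h.uniq (h.cyc (h.cyc hq)) hus)
      have hpq := h.ne (h.cyc hq)
      obtain ⟨_, huq⟩ := h.symm (h.cyc (h.cyc hq))
      have hp : φ p ∈ ((nbr t u).erase v).image φ :=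
        Finset.mem_image_of_mem _ (Finset.mem_erase.2 ⟨hpv.symm, mem_nbr.2 ⟨_, hq⟩⟩)
      have hq' : φ q ∈ ((nbr t u).erase v).image φ :=
        Finset.mem_image_of_mem _ (Finset.mem_erase.2 ⟨hqv, mem_nbr.2 ⟨_, huq⟩⟩)
      obtain ⟨_, hpq'⟩ := ht'.keep (h.cyc hq) hpv.symm hqv
      obtain ⟨x, hx⟩ := exists_three_le_card_insert hp
        (Finset.one_lt_card.2 ⟨_, hp, _, hq', hφ hpq'⟩)
      refine ⟨x, fun p' s' hp' _ _ => ?_⟩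
      rwa [h.pred_unique hp' hpu]
    · push Not at hu
      exact ⟨0, fun p s h₁ h₂ h₃ => absurd (hu p s h₁ h₂) h₃⟩
  choose ex hex using key
  exact ⟨ex, fun p u s => hex u p s⟩

/-- Color `v` with `c`. -/
lemma isThreeDynamic_update (h : IsTriangulatedSphere S t) (ht' : IsReduction S t t' v)
    (hφ : IsThreeDynamic (S.erase v) t' φ) {c : ℕ} (hc : ∀ u z, t v u z → c ≠ φ u)
    (hc' : ∀ p u s, t v p u → t v u s → p ≠ s → φ p = φ s →
      3 ≤ (insert c (((nbr t u).erase v).image φ)).card)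
    (hv : 3 ≤ ((nbr t v).image φ).card) : IsThreeDynamic S t (Function.update φ v c) := by
  have hupd : ∀ u, u ≠ v → Function.update φ v c u = φ u := fun u hu =>
    Function.update_of_ne hu _ _
  refine ⟨fun {x y z} hxy => ?_, fun u hu hdeg => ?_⟩
  · have hne := h.ne hxy
    obtain ⟨w, hw⟩ := h.symm hxy
    by_cases hx : x = v
    · subst hx
      rw [Function.update_self, hupd y hne.symm]
      exact hc _ _ hxy
    by_cases hy : y = v
    · subst hy
      rw [Function.update_self, hupd x hne]
      exact (hc _ _ hw).symm
    obtain ⟨_, hxy'⟩ := ht'.keep hxy hx hy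
    rw [hupd x hx, hupd y hy]
    exact hφ.proper hxy'
  by_cases huv : u = v
  · subst huv
    refine hv.trans_eq (congrArg _ (Finset.image_congr fun y hy => (hupd y ?_).symm))
    obtain ⟨z, hz⟩ := mem_nbr.1 hy
    exact (h.ne hz).symm
  by_cases hvu : ∃ s, t v u s
  · obtain ⟨s, hus⟩ := hvu
    obtain ⟨p, hup⟩ := h.symm hus
    have hpu : t v p u := h.cyc hup
    have huvs := h.cyc (h.cyc hus)
    have himg : (nbr t u).image (Function.update φ v c) =
        insert c (((nbr t u).erase v).image φ) := by
      rw [← Finset.insert_erase (mem_nbr.2 ⟨_, hup⟩), Finset.image_insert, Function.update_self,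
        Finset.insert_erase (mem_nbr.2 ⟨_, hup⟩)]
      exact congrArg _ (Finset.image_congr fun y hy => hupd y (Finset.mem_erase.1 hy).1)
    have hps : p ≠ s := by
      rintro rfl
      have : nbr t u ⊆ {v, p} := fun y hy => by
        obtain ⟨z, hz⟩ := mem_nbr.1 hy
        simpa using h.mem_pair hup (h.cyc hus) hz
      have := (Finset.card_le_card this).trans Finset.card_le_two
      omega
    rw [himg]
    by_cases hpsφ : φ p = φ s
    · exact hc' _ _ _ hpu hus hps hpsφ
    · obtain ⟨_, hup'⟩ := h.symm (h.cyc hpu)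
      have : ({c, φ p, φ s} : Finset ℕ) ⊆ insert c (((nbr t u).erase v).image φ) := by
        refine Finset.insert_subset_insert _ (Finset.insert_subset_iff.2 ⟨?_,
          Finset.singleton_subset_iff.2 ?_⟩) <;> refine Finset.mem_image_of_mem _ ?_
        · exact Finset.mem_erase.2 ⟨(h.ne hpu).symm, mem_nbr.2 ⟨_, hup'⟩⟩
        · exact Finset.mem_erase.2 ⟨h.ne huvs, mem_nbr.2 ⟨_, h.cyc hus⟩⟩
      obtain ⟨_, hvs⟩ := h.symm huvs
      refine le_trans ?_ (Finset.card_le_card this)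
      rw [Finset.card_eq_three.2 ⟨c, φ p, φ s, hc _ _ hpu, hc _ _ hvs, hpsφ, rfl⟩]
  · have hnbr : nbr t u = nbr t' u := by
      ext y
      rw [mem_nbr, mem_nbr]
      constructor
      · rintro ⟨z, hz⟩
        exact ht'.keep hz huv (by
          rintro rfl
          exact hvu (h.symm hz))
      · rintro ⟨z, hz⟩
        exact (ht'.sub hz).resolve_right hvu
    have himg : (nbr t u).image (Function.update φ v c) = (nbr t u).image φ := by
      refine Finset.image_congr fun y hy => hupd y ?_
      rintro rfl
      obtain ⟨z, hz⟩ := mem_nbr.1 hy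
      exact hvu (h.symm hz)
    rw [himg, hnbr]
    rw [hnbr] at hdeg
    exact hφ.three_le u (Finset.mem_erase.2 ⟨huv, hu⟩) hdeg

/-- Extend a coloring over `v`, avoiding a list of at most five colors. -/
lemma exists_extension (h : IsTriangulatedSphere S t) {L : V → Finset ℕ}
    (hL : ∀ v, 6 ≤ (L v).card) (ht' : IsReduction S t t' v)
    (hφL : ∀ u ∈ S.erase v, φ u ∈ L u) (hφ : IsThreeDynamic (S.erase v) t' φ)
    (hv : 3 ≤ ((nbr t v).image φ).card)
    (hF : ∀ ex : V → ℕ, ∃ F : Finset ℕ, F.card ≤ 5 ∧ (∀ u z, t v u z → φ u ∈ F) ∧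
      ∀ p u s, t v p u → t v u s → p ≠ s → φ p = φ s → ex u ∈ F) :
    ∃ φ : V → ℕ, (∀ u ∈ S, φ u ∈ L u) ∧ IsThreeDynamic S t φ := by
  obtain ⟨ex, hex⟩ := h.exists_extra_color ht' hφ.proper
  obtain ⟨F, hcard, hF, hexF⟩ := hF ex
  obtain ⟨c, hcL, hcF⟩ := Finset.exists_mem_notMem_of_card_lt_card (hcard.trans_lt (hL v))
  have hc : ∀ u z, t v u z → c ≠ φ u := fun u z huz hcu => hcF (hcu ▸ hF u z huz)
  refine ⟨Function.update φ v c, fun u hu => ?_, h.isThreeDynamic_update ht' hφ hc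
    (fun p u s hpu hus hps hpsφ => hex p u s hpu hus hps c (hc _ _ hpu) fun hcx =>
      hcF (hcx ▸ hexF p u s hpu hus hps hpsφ)) hv⟩
  by_cases huv : u = v
  · subst huv
    rwa [Function.update_self]
  · rw [Function.update_of_ne huv]
    exact hφL u (Finset.mem_erase.2 ⟨huv, hu⟩)

lemma proper_of_link (h : IsTriangulatedSphere S t) (ht' : IsReduction S t t' v)
    (hφ : IsThreeDynamic (S.erase v) t' φ) {x y : V} (hxy : t v x y) : φ x ≠ φ y := by
  obtain ⟨z, hz⟩ := ht'.keep (h.cyc hxy) (h.ne hxy).symm (h.ne (h.cyc (h.cyc hxy)))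
  exact hφ.proper hz

lemma exists_extension_three (h : IsTriangulatedSphere S t) {L : V → Finset ℕ}
    (hL : ∀ v, 6 ≤ (L v).card) (ht' : IsReduction S t t' v)
    (hφL : ∀ u ∈ S.erase v, φ u ∈ L u) (hφ : IsThreeDynamic (S.erase v) t' φ) {a b c : V}
    (hab : t v a b) (hbc : t v b c) (hca : t v c a) :
    ∃ φ : V → ℕ, (∀ u ∈ S, φ u ∈ L u) ∧ IsThreeDynamic S t φ := by
  have n₁ := h.proper_of_link ht' hφ hab
  have n₂ := h.proper_of_link ht' hφ hbc
  have n₃ := h.proper_of_link ht' hφ hca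
  refine h.exists_extension hL ht' hφL hφ (three_le_card_image (mem_nbr.2 ⟨_, hab⟩)
    (mem_nbr.2 ⟨_, hbc⟩) (mem_nbr.2 ⟨_, hca⟩) n₁ n₃.symm n₂) fun ex =>
    ⟨{φ a, φ b, φ c}, Finset.card_le_three.trans (by norm_num), fun u z huz => ?_,
      fun p u s hpu hus hps hpsφ => ?_⟩
  · have := h.link_three hab hbc hca huz
    grind
  · have := h.link_three hab hbc hca hpu
    have := @h.uniq
    grind

lemma exists_extension_four (h : IsTriangulatedSphere S t) {L : V → Finset ℕ}
    (hL : ∀ v, 6 ≤ (L v).card) (ht' : IsReduction S t t' v)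
    (hφL : ∀ u ∈ S.erase v, φ u ∈ L u) (hφ : IsThreeDynamic (S.erase v) t' φ) {a b c d : V}
    (hab : t v a b) (hbc : t v b c) (hcd : t v c d) (hda : t v d a) (hac : φ a ≠ φ c) :
    ∃ φ : V → ℕ, (∀ u ∈ S, φ u ∈ L u) ∧ IsThreeDynamic S t φ := by
  have n₁ := h.proper_of_link ht' hφ hab
  have n₂ := h.proper_of_link ht' hφ hbc
  refine h.exists_extension hL ht' hφL hφ (three_le_card_image (mem_nbr.2 ⟨_, hab⟩)
    (mem_nbr.2 ⟨_, hbc⟩) (mem_nbr.2 ⟨_, hcd⟩) n₁ hac n₂) fun ex => ?_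
  by_cases hbd : φ b = φ d
  · refine ⟨{φ a, φ b, φ c, ex a, ex c}, Finset.card_le_five, fun u z huz => ?_,
      fun p u s hpu hus hps hpsφ => ?_⟩
    · have := h.mem_four hab hbc hcd hda huz
      grind
    · have := h.mem_four hab hbc hcd hda hpu
      have := @h.uniq
      grind
  · refine ⟨{φ a, φ b, φ c, φ d}, Finset.card_le_four.trans (by norm_num), fun u z huz => ?_,
      fun p u s hpu hus hps hpsφ => ?_⟩
    · have := h.mem_four hab hbc hcd hda huz
      grind
    · have := h.mem_four hab hbc hcd hda hpu
      have := @h.uniq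
      grind

lemma exists_extension_five (h : IsTriangulatedSphere S t) {L : V → Finset ℕ}
    (hL : ∀ v, 6 ≤ (L v).card) (ht' : IsReduction S t t' v)
    (hφL : ∀ u ∈ S.erase v, φ u ∈ L u) (hφ : IsThreeDynamic (S.erase v) t' φ) {a b c d e : V}
    (hab : t v a b) (hbc : t v b c) (hcd : t v c d) (hde : t v d e) (hea : t v e a) :
    ∃ φ : V → ℕ, (∀ u ∈ S, φ u ∈ L u) ∧ IsThreeDynamic S t φ := by
  have n₁ := h.proper_of_link ht' hφ hab
  have n₂ := h.proper_of_link ht' hφ hbc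
  have n₃ := h.proper_of_link ht' hφ hcd
  have n₄ := h.proper_of_link ht' hφ hde
  have n₅ := h.proper_of_link ht' hφ hea
  have hu := @h.uniq
  refine h.exists_extension hL ht' hφL hφ ?_ fun ex =>
    ⟨{if φ a = φ c then ex b else φ c, if φ b = φ d then ex c else φ d,
      if φ c = φ e then ex d else φ e, if φ d = φ a then ex e else φ a,
      if φ e = φ b then ex a else φ b}, Finset.card_le_five, fun u z huz => ?_,
      fun p u s hpu hus hps hpsφ => ?_⟩
  · have ha := mem_nbr.2 ⟨_, hab⟩
    have hb := mem_nbr.2 ⟨_, hbc⟩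
    have hc := mem_nbr.2 ⟨_, hcd⟩
    have hd := mem_nbr.2 ⟨_, hde⟩
    have he := mem_nbr.2 ⟨_, hea⟩
    by_cases h₁ : φ a = φ c
    · by_cases h₂ : φ b = φ d
      · exact three_le_card_image hd he ha n₄ (by rwa [← h₂, ne_comm]) n₅
      · exact three_le_card_image hb hc hd n₂ h₂ n₃
    · exact three_le_card_image ha hb hc n₁ h₁ n₂
  · have := h.mem_five hab hbc hcd hde hea huz
    simp only [Finset.mem_insert, Finset.mem_singleton]
    grind
  · simp only [Finset.mem_insert, Finset.mem_singleton]
    rcases h.mem_five hab hbc hcd hde hea hpu with rfl | rfl | rfl | rfl | rfl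
    · obtain rfl := hu hpu hab
      obtain rfl := hu hus hbc
      simp [hpsφ]
    · obtain rfl := hu hpu hbc
      obtain rfl := hu hus hcd
      simp [hpsφ]
    · obtain rfl := hu hpu hcd
      obtain rfl := hu hus hde
      simp [hpsφ]
    · obtain rfl := hu hpu hde
      obtain rfl := hu hus hea
      simp [hpsφ]
    · obtain rfl := hu hpu hea
      obtain rfl := hu hus hab
      simp [hpsφ]

theorem exists_isThreeDynamic (h : IsTriangulatedSphere S t) {L : V → Finset ℕ}
    (hL : ∀ v, 6 ≤ (L v).card) : ∃ φ : V → ℕ, (∀ u ∈ S, φ u ∈ L u) ∧ IsThreeDynamic S t φ := by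
  induction hn : S.card using Nat.strong_induction_on generalizing S t with
  | _ n ih =>
  by_cases hS : S.card ≤ 3
  · obtain ⟨φ, hφL, hφ⟩ := exists_injOn_of_card_le hL S (hS.trans (by norm_num))
    have hmem : ∀ {x y z}, t x y z → x ∈ S := fun hxy => (h.mem_iff _).2 ⟨_, _, hxy⟩
    refine ⟨φ, hφL, fun hxy hφxy => h.ne hxy (hφ (hmem hxy) (hmem (h.cyc hxy)) hφxy),
      fun u hu hdeg => ?_⟩
    have hsub : nbr t u ⊆ S.erase u := fun y hy => by
      obtain ⟨z, hz⟩ := mem_nbr.1 hy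
      exact Finset.mem_erase.2 ⟨(h.ne hz).symm, hmem (h.cyc hz)⟩
    have := Finset.card_le_card hsub
    rw [Finset.card_erase_of_mem hu] at this
    omega
  obtain ⟨v, hv, hdeg⟩ := h.exists_card_nbr_le_five
  have hind : ∀ {t'}, IsReduction S t t' v → ∃ φ : V → ℕ, (∀ u ∈ S.erase v, φ u ∈ L u) ∧
      IsThreeDynamic (S.erase v) t' φ := fun ht' =>
    ih _ (hn ▸ Finset.card_erase_lt_of_mem hv) ht'.sphere rfl
  rcases h.exists_link_cycle hv hdeg with ⟨a, b, hab, hba⟩ | ⟨a, b, c, hab, hbc, hca⟩ |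
    ⟨a, b, c, d, hab, hbc, hcd, hda, hac, hbd⟩ |
    ⟨a, b, c, d, e, hab, hbc, hcd, hde, hea, hac, had, hbd, hbe, hce⟩
  · exact absurd (h.card_le_three_of_link_pair hab hba) hS
  · have ht' := h.isReduction_three hab hbc hca
    obtain ⟨φ, hφL, hφ⟩ := hind ht'
    exact h.exists_extension_three hL ht' hφL hφ hab hbc hca
  · by_cases hadj : ∃ z, t a c z
    · obtain ⟨t', ht', z, hz⟩ := h.exists_isReduction_four hbc hcd hda hab hbd
        (h.not_adj_of_crossing hab hbc hadj ⟨_, hda⟩ (h.ne (h.cyc hda)) (h.ne (h.cyc hcd)).symm)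
      obtain ⟨φ, hφL, hφ⟩ := hind ht'
      exact h.exists_extension_four hL ht' hφL hφ hbc hcd hda hab (hφ.proper hz)
    · obtain ⟨t', ht', z, hz⟩ := h.exists_isReduction_four hab hbc hcd hda hac hadj
      obtain ⟨φ, hφL, hφ⟩ := hind ht'
      exact h.exists_extension_four hL ht' hφL hφ hab hbc hcd hda (hφ.proper hz)
  · obtain ⟨t', ht'⟩ := h.exists_isReduction_five hab hbc hcd hde hea hac had hbd hbe hce
    obtain ⟨φ, hφL, hφ⟩ := hind ht'
    exact h.exists_extension_five hL ht' hφL hφ hab hbc hcd hde hea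

end Coloring

end IsTriangulatedSphere

namespace RotationSystem

variable {V : Type} [Fintype V] [DecidableEq V] (P : RotationSystem V)

lemma facePerm_symm (d : P.graph.Dart) : P.facePerm d.symm = P.rot d :=
  congrArg P.rot d.symm_symm

lemma facePerm_fst (d : P.graph.Dart) : (P.facePerm d).fst = d.snd :=
  P.rot_fst d.symm

lemma facePerm_ne (d : P.graph.Dart) : P.facePerm d ≠ d := fun h =>
  d.fst_ne_snd ((congrArg (fun e => e.fst) h).symm.trans (P.facePerm_fst d))

lemma sameFace_facePerm {d e : P.graph.Dart} (h : P.SameFace d e) :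
    P.SameFace d (P.facePerm e) :=
  Equiv.Perm.sameCycle_apply_right.2 h

lemma facePerm_facePerm_ne {d : P.graph.Dart} (hd : P.faceSize d = 3) :
    P.facePerm (P.facePerm d) ≠ d := by
  classical
  intro h
  have hsub : {e | P.SameFace d e} ⊆ ({d, P.facePerm d} : Finset P.graph.Dart) := by
    intro e he
    obtain ⟨n, rfl⟩ := Equiv.Perm.SameCycle.exists_nat_pow_eq he
    clear he
    induction n with
    | zero => simp
    | succ n ih =>
      rw [pow_succ', Equiv.Perm.mul_apply]
      simp only [Finset.coe_insert, Finset.coe_singleton, Set.mem_insert_iff,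
        Set.mem_singleton_iff] at ih ⊢
      rcases ih with ih | ih <;> rw [ih]
      exacts [Or.inr rfl, Or.inl h]
  have := Set.ncard_le_ncard hsub (Finset.finite_toSet _)
  rw [Set.ncard_coe_finset] at this
  have := this.trans Finset.card_le_two
  unfold faceSize at hd
  omega

/-- The darts of a face of size three. -/
lemma sameFace_iff {d e : P.graph.Dart} (hd : P.faceSize d = 3) :
    P.SameFace d e ↔ e = d ∨ e = P.facePerm d ∨ e = P.facePerm (P.facePerm d) := by
  classical
  have s₀ : P.SameFace d d := Equiv.Perm.SameCycle.refl _ _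
  have hset : (({d, P.facePerm d, P.facePerm (P.facePerm d)} : Finset P.graph.Dart) :
      Set P.graph.Dart) = {e | P.SameFace d e} := by
    refine Set.eq_of_subset_of_ncard_le ?_ ?_ (Set.toFinite _)
    · intro e he
      simp only [Finset.coe_insert, Finset.coe_singleton, Set.mem_insert_iff,
        Set.mem_singleton_iff] at he
      rcases he with rfl | rfl | rfl
      exacts [s₀, P.sameFace_facePerm s₀, P.sameFace_facePerm (P.sameFace_facePerm s₀)]
    · rw [Set.ncard_coe_finset, Finset.card_eq_three.2 ⟨_, _, _, (P.facePerm_ne d).symm,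
        (P.facePerm_facePerm_ne hd).symm, (P.facePerm_ne _).symm, rfl⟩]
      exact hd.le
  simpa using (Set.ext_iff.1 hset e).symm

lemma facePerm_cube {d : P.graph.Dart} (hd : P.faceSize d = 3) :
    P.facePerm (P.facePerm (P.facePerm d)) = d := by
  have s : P.SameFace d (P.facePerm (P.facePerm (P.facePerm d))) :=
    P.sameFace_facePerm (P.sameFace_facePerm (P.sameFace_facePerm (Equiv.Perm.SameCycle.refl _ _)))
  rcases (P.sameFace_iff hd).1 s with h | h | h
  · exact h
  · exact absurd (P.facePerm.injective h) (P.facePerm_facePerm_ne hd)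
  · exact absurd h (P.facePerm_ne _)

/-- A property of darts that is invariant under reversal and under the face permutation holds for
all darts or for none. -/
lemma dart_induction (p : P.graph.Dart → Prop) (hs : ∀ d, p d → p d.symm)
    (hf : ∀ d, p d → p (P.facePerm d)) {d : P.graph.Dart} (hd : p d) (e : P.graph.Dart) : p e := by
  have hrot : ∀ d e : P.graph.Dart, d.fst = e.fst → p d → p e := by
    intro d e hde hd
    obtain ⟨n, rfl⟩ := P.rot_orbit d e hde
    clear hde
    induction n with
    | zero => exact hd
    | succ n ih =>
      rw [pow_succ', Equiv.Perm.mul_apply, ← facePerm_symm]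
      exact hf _ (hs _ ih)
  have hreach : ∀ {x y}, P.graph.Walk x y → (∃ d, d.fst = x ∧ p d) →
      ∃ d, d.fst = y ∧ p d := by
    intro x y w
    induction w with
    | nil => exact id
    | @cons u v _ hadj _ ih =>
      rintro ⟨d, hdu, hd⟩
      exact ih ⟨(⟨(u, v), hadj⟩ : P.graph.Dart).symm, rfl, hs _ (hrot d ⟨(u, v), hadj⟩ hdu hd)⟩
  obtain ⟨w⟩ := P.conn.preconnected d.fst e.fst
  obtain ⟨d', hd', hpd'⟩ := hreach w ⟨d, rfl, hd⟩
  exact hrot d' e hd' hpd'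

end RotationSystem

namespace Triangulation

variable {V : Type} [Fintype V] [DecidableEq V] (P : Triangulation V)

/-- The oriented triangles of a triangulation. -/
def triangle (x y z : V) : Prop :=
  ∃ d : P.graph.Dart, d.fst = x ∧ d.snd = y ∧ (P.facePerm d).snd = z

lemma exists_triangle_iff {x y : V} : (∃ z, P.triangle x y z) ↔ P.graph.Adj x y := by
  constructor
  · rintro ⟨_, d, rfl, rfl, _⟩
    exact d.adj
  · exact fun h => ⟨_, ⟨(x, y), h⟩, rfl, rfl, rfl⟩

lemma triangle_cyc {x y z : V} (h : P.triangle x y z) : P.triangle y z x := by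
  obtain ⟨d, rfl, rfl, rfl⟩ := h
  refine ⟨P.facePerm d, P.facePerm_fst d, rfl, ?_⟩
  rw [← P.facePerm_fst, P.facePerm_cube (P.all_tri d)]

lemma nontrivial (P : Triangulation V) : Nontrivial V := by
  by_contra hV
  rw [not_nontrivial_iff_subsingleton] at hV
  obtain ⟨v⟩ := P.conn.nonempty
  have hd : IsEmpty P.graph.Dart := ⟨fun d => d.fst_ne_snd (Subsingleton.elim _ _)⟩
  have he : IsEmpty P.graph.edgeSet := ⟨fun ⟨e, he⟩ => by
    induction e with
    | _ x y => exact he.ne (Subsingleton.elim _ _)⟩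
  have hF : IsEmpty (Quotient P.faceSetoid) := ⟨fun q => hd.elim q.out⟩
  have := P.plane
  have hc := Fintype.card_le_one_iff_subsingleton.2 hV
  simp only [RotationSystem.IsPlane, RotationSystem.numFaces, Nat.card_of_isEmpty] at this
  omega

lemma card_dart : Nat.card P.graph.Dart = 2 * Nat.card P.graph.edgeSet := by
  classical
  rw [Nat.card_eq_fintype_card, P.graph.dart_card_eq_twice_card_edges, Nat.card_eq_fintype_card,
    edgeFinset_card]

lemma card_dart_eq_three_mul : Nat.card P.graph.Dart = 3 * P.numFaces := by
  classical
  have hfib : ∀ q : Quotient P.faceSetoid,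
      Nat.card {d // (Quotient.mk P.faceSetoid d) = q} = 3 := by
    intro q
    induction q using Quotient.inductionOn with
    | _ d =>
    refine Eq.trans ?_ (P.all_tri d)
    refine (Nat.card_congr (Equiv.subtypeEquivRight fun e => ?_)).trans
      (Nat.card_coe_set_eq _)
    exact Quotient.eq.trans ⟨fun h => h.symm, fun h => h.symm⟩
  rw [Nat.card_congr (Equiv.sigmaFiberEquiv (Quotient.mk P.faceSetoid)).symm, Nat.card_sigma]
  simp_rw [hfib]
  rw [RotationSystem.numFaces, Finset.sum_const, Finset.card_univ, Nat.card_eq_fintype_card,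
    smul_eq_mul, mul_comm]

/-- The simplicial coboundary from vertices to edges. -/
def vertexCoboundary : (V → ZMod 2) →ₗ[ZMod 2] (P.graph.edgeSet → ZMod 2) where
  toFun g e := Sym2.lift ⟨fun x y => g x + g y, fun _ _ => add_comm _ _⟩ e.1
  map_add' g g' := by
    ext ⟨e, he⟩
    induction e with
    | _ x y => exact add_add_add_comm _ _ _ _
  map_smul' r g := by
    ext ⟨e, he⟩
    induction e with
    | _ x y => exact (mul_add _ _ _).symm

open Classical in
/-- The simplicial coboundary from edges to faces. -/
noncomputable def edgeCoboundary :
    (P.graph.edgeSet → ZMod 2) →ₗ[ZMod 2] (Quotient P.faceSetoid → ZMod 2) where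
  toFun w q := ∑ d with Quotient.mk P.faceSetoid d = q, w ⟨d.edge, d.edge_mem⟩
  map_add' w w' := by
    ext q
    exact Finset.sum_add_distrib
  map_smul' r w := by
    ext q
    exact (Finset.mul_sum _ _ _).symm

lemma edgeCoboundary_mk (w : P.graph.edgeSet → ZMod 2) (d : P.graph.Dart) :
    P.edgeCoboundary w (Quotient.mk _ d) = w ⟨d.edge, d.edge_mem⟩ +
      w ⟨(P.facePerm d).edge, (P.facePerm d).edge_mem⟩ +
      w ⟨(P.facePerm (P.facePerm d)).edge, (P.facePerm (P.facePerm d)).edge_mem⟩ := by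
  classical
  have hset : ({e | Quotient.mk P.faceSetoid e = Quotient.mk P.faceSetoid d} :
      Finset P.graph.Dart) = {d, P.facePerm d, P.facePerm (P.facePerm d)} := by
    ext e
    simp only [Finset.mem_filter, Finset.mem_univ, true_and, Finset.mem_insert,
      Finset.mem_singleton]
    rw [← P.sameFace_iff (P.all_tri d), eq_comm]
    exact Quotient.eq
  refine (Finset.sum_congr ?_ fun _ _ => rfl).trans (?_ : ∑ e ∈ ({d, P.facePerm d,
    P.facePerm (P.facePerm d)} : Finset P.graph.Dart), w ⟨e.edge, e.edge_mem⟩ = _)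
  · convert hset
  rw [Finset.sum_insert, Finset.sum_pair (P.facePerm_ne _).symm, add_assoc]
  simp only [Finset.mem_insert, Finset.mem_singleton, not_or]
  exact ⟨(P.facePerm_ne d).symm, (P.facePerm_facePerm_ne (P.all_tri d)).symm⟩

open Classical in
lemma edgeCoboundary_single (d : P.graph.Dart) :
    P.edgeCoboundary (Pi.single ⟨d.edge, d.edge_mem⟩ 1) =
      Pi.single (Quotient.mk _ d) 1 + Pi.single (Quotient.mk _ d.symm) 1 := by
  classical
  ext q
  have key : ∀ e : P.graph.Dart,
      (Pi.single (M := fun _ : P.graph.edgeSet => ZMod 2) ⟨d.edge, d.edge_mem⟩ 1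
        ⟨e.edge, e.edge_mem⟩) =
        (if e = d then 1 else 0) + if e = d.symm then 1 else 0 := by
    intro e
    rw [Pi.single_apply]
    simp only [Subtype.mk.injEq, dart_edge_eq_iff]
    have := d.symm_ne
    split_ifs <;> simp_all
  refine (Finset.sum_congr rfl fun e _ => key e).trans ?_
  rw [Finset.sum_add_distrib, Finset.sum_ite_eq', Finset.sum_ite_eq', Pi.add_apply,
    Pi.single_apply, Pi.single_apply]
  simp only [Finset.mem_filter, Finset.mem_univ, true_and, eq_comm (a := q)]

lemma finrank_ker_vertexCoboundary_le :
    Module.finrank (ZMod 2) (LinearMap.ker P.vertexCoboundary) ≤ 1 := by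
  have hle : LinearMap.ker P.vertexCoboundary ≤ Submodule.span (ZMod 2) {fun _ => 1} := by
    intro g hg
    have hadj : ∀ x y, P.graph.Adj x y → g x = g y := fun x y hxy => by
      have := congrFun (LinearMap.mem_ker.1 hg) ⟨s(x, y), hxy⟩
      exact CharTwo.add_eq_zero.1 this
    have hwalk : ∀ {x y}, P.graph.Walk x y → g x = g y := fun w => by
      induction w with
      | nil => rfl
      | cons hxy _ ih => exact (hadj _ _ hxy).trans ih
    obtain ⟨v⟩ := P.conn.nonempty
    refine Submodule.mem_span_singleton.2 ⟨g v, funext fun x => ?_⟩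
    obtain ⟨w⟩ := P.conn.preconnected v x
    simpa using hwalk w
  exact (Submodule.finrank_mono hle).trans ((finrank_span_le_card _).trans (by simp))

lemma finrank_range_edgeCoboundary :
    P.numFaces ≤ Module.finrank (ZMod 2) (LinearMap.range P.edgeCoboundary) + 1 := by
  classical
  have := P.nontrivial
  obtain ⟨x⟩ := P.conn.nonempty
  obtain ⟨z, hz⟩ := P.conn.preconnected.exists_adj_of_nontrivial x
  let d₀ : P.graph.Dart := ⟨(x, z), hz⟩
  let W := LinearMap.range P.edgeCoboundary ⊔
    Submodule.span (ZMod 2) {Pi.single (Quotient.mk P.faceSetoid d₀) (1 : ZMod 2)}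
  have hW : W = ⊤ := by
    rw [eq_top_iff, ← (Pi.basisFun (ZMod 2) (Quotient P.faceSetoid)).span_eq, Submodule.span_le]
    rintro _ ⟨q, rfl⟩
    rw [Pi.basisFun_apply]
    induction q using Quotient.inductionOn with
    | _ d =>
    refine P.dart_induction (fun d => Pi.single (Quotient.mk P.faceSetoid d) (1 : ZMod 2) ∈ W)
      (fun d hd => ?_) (fun d hd => ?_)
      (Submodule.mem_sup_right (Submodule.mem_span_singleton_self _) : _ ∈ W) d
    · have : P.edgeCoboundary (Pi.single ⟨d.edge, d.edge_mem⟩ 1) ∈ W :=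
        Submodule.mem_sup_left (LinearMap.mem_range_self _ _)
      rw [P.edgeCoboundary_single] at this
      exact (Submodule.add_mem_iff_right _ hd).1 this
    · rwa [show Quotient.mk P.faceSetoid (P.facePerm d) = Quotient.mk P.faceSetoid d from
        (Quotient.sound (P.sameFace_facePerm (Equiv.Perm.SameCycle.refl _ _))).symm]
  calc P.numFaces = Module.finrank (ZMod 2) W := by
        rw [hW, finrank_top, Module.finrank_fintype_fun_eq_card, RotationSystem.numFaces,
          Nat.card_eq_fintype_card]
    _ ≤ _ := Submodule.finrank_add_le_finrank_add_finrank _ _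
    _ ≤ _ := Nat.add_le_add_left ((finrank_span_le_card _).trans (by simp)) _

lemma range_vertexCoboundary :
    LinearMap.range P.vertexCoboundary = LinearMap.ker P.edgeCoboundary := by
  classical
  refine Submodule.eq_of_le_of_finrank_le ?_ ?_
  · rintro _ ⟨g, rfl⟩
    rw [LinearMap.mem_ker]
    ext q
    induction q using Quotient.inductionOn with
    | _ d =>
    rw [edgeCoboundary_mk]
    have h₁ : ∀ d : P.graph.Dart, P.vertexCoboundary g ⟨d.edge, d.edge_mem⟩ = g d.fst + g d.snd :=
      fun d => rfl
    have h₂ : (P.facePerm (P.facePerm d)).snd = d.fst := by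
      rw [← P.facePerm_fst, P.facePerm_cube (P.all_tri d)]
    rw [h₁, h₁, h₁, h₂, P.facePerm_fst, P.facePerm_fst]
    simp only [Pi.zero_apply]
    linear_combination CharTwo.add_self_eq_zero (g d.fst) + CharTwo.add_self_eq_zero (g d.snd) +
      CharTwo.add_self_eq_zero (g (P.facePerm d).snd)
  · have h₁ := P.vertexCoboundary.finrank_range_add_finrank_ker
    have h₂ := P.edgeCoboundary.finrank_range_add_finrank_ker
    have h₃ := P.finrank_ker_vertexCoboundary_le
    have h₄ := P.finrank_range_edgeCoboundary
    have h₅ := P.plane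
    rw [Module.finrank_fintype_fun_eq_card] at h₁ h₂
    rw [RotationSystem.IsPlane, Nat.card_eq_fintype_card] at h₅
    omega

theorem isTriangulatedSphere : IsTriangulatedSphere Finset.univ P.triangle where
  cyc h := P.triangle_cyc h
  ne h := (P.exists_triangle_iff.1 ⟨_, h⟩).ne
  uniq := by
    rintro x y z w ⟨d, rfl, rfl, rfl⟩ ⟨e, h₁, h₂, rfl⟩
    rw [show e = d from Dart.ext _ _ (Prod.ext h₁ h₂)]
  symm h := P.exists_triangle_iff.2 (P.exists_triangle_iff.1 ⟨_, h⟩).symm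
  mem_iff x := by
    have := P.nontrivial
    simp only [Finset.mem_univ, true_iff, P.exists_triangle_iff]
    exact P.conn.preconnected.exists_adj_of_nontrivial x
  link := by
    rintro v p hp x y x' y' ⟨d, rfl, rfl, -⟩ ⟨e, hed, rfl, -⟩ hx
    have hfst : ∀ n, ((P.rot ^ n) d).fst = d.fst := fun n => by
      induction n with
      | zero => rfl
      | succ n ih => rw [pow_succ', Equiv.Perm.mul_apply, P.rot_fst, ih]
    obtain ⟨n, rfl⟩ := P.rot_orbit d e hed.symm
    clear hed
    induction n with
    | zero => exact hx
    | succ n ih =>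
      rw [pow_succ', Equiv.Perm.mul_apply]
      set e := (P.rot ^ n) d with he
      refine (hp _ e.snd ⟨P.rot e, ?_, rfl, ?_⟩).2 ih
      · rw [P.rot_fst, he, hfst]
      · rw [← P.facePerm_fst, ← P.facePerm_symm, P.facePerm_cube (P.all_tri _)]
        rfl
  conn p hp x _ y _ hx := by
    obtain ⟨w⟩ := P.conn.preconnected x y
    induction w with
    | nil => exact hx
    | cons hxy _ ih =>
      obtain ⟨_, h⟩ := P.exists_triangle_iff.2 hxy
      exact ih (Finset.mem_univ _) (Finset.mem_univ _) ((hp _ _ _ h).1 hx)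
  exact f hf hface := by
    let w : P.graph.edgeSet → ZMod 2 := fun e => Sym2.lift ⟨f, hf⟩ e.1
    have hw : w ∈ LinearMap.ker P.edgeCoboundary := by
      rw [LinearMap.mem_ker]
      ext q
      induction q using Quotient.inductionOn with
      | _ d =>
      rw [edgeCoboundary_mk]
      have h₁ : ∀ d : P.graph.Dart, w ⟨d.edge, d.edge_mem⟩ = f d.fst d.snd := fun d => rfl
      have h₂ : (P.facePerm (P.facePerm d)).snd = d.fst := by
        rw [← P.facePerm_fst, P.facePerm_cube (P.all_tri d)]
      rw [h₁, h₁, h₁, h₂, P.facePerm_fst, P.facePerm_fst]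
      exact hface _ _ _ ⟨d, rfl, rfl, rfl⟩
    rw [← P.range_vertexCoboundary] at hw
    obtain ⟨g, hg⟩ := hw
    exact ⟨g, fun x y z h => (congrFun hg ⟨s(x, y), P.exists_triangle_iff.1 ⟨_, h⟩⟩).symm⟩
  count := by
    have h₁ := P.card_dart
    have h₂ := P.card_dart_eq_three_mul
    have h₃ := P.plane
    have h₄ : Nat.card {e : V × V // ∃ z, P.triangle e.1 e.2 z} = Nat.card P.graph.Dart :=
      Nat.card_congr ⟨fun e => ⟨e.1, P.exists_triangle_iff.1 e.2⟩,
        fun d => ⟨d.toProd, P.exists_triangle_iff.2 d.adj⟩, fun _ => rfl, fun _ => rfl⟩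
    rw [RotationSystem.IsPlane] at h₃
    rw [h₄, Finset.card_univ]
    omega

end Triangulation

/-- **Corollary 1.4 (Gu–Kim–Ma–Shi).** If `G` is a triangulated planar graph, then
`ch₃ᵈ(G) ≤ 6`. -/
theorem triangulation_list_three_dynamic_six {V : Type} [Fintype V] [DecidableEq V]
    (P : Triangulation V) (L : V → Finset ℕ) (hL : ∀ v : V, 6 ≤ (L v).card) :
    ∃ φ : V → ℕ, (∀ v : V, φ v ∈ L v) ∧ IsDynColoring P.graph 3 φ := by
  have h := P.isTriangulatedSphere
  obtain ⟨φ, hφL, hφ⟩ := h.exists_isThreeDynamic hL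
  refine ⟨φ, fun v => hφL v (Finset.mem_univ v), fun u v huv => ?_, fun v => ?_⟩
  · obtain ⟨_, ht⟩ := P.exists_triangle_iff.2 huv
    exact hφ.proper ht
  · have hnbr : P.graph.neighborSet v = IsTriangulatedSphere.nbr P.triangle v := by
      ext y
      rw [Finset.mem_coe, IsTriangulatedSphere.mem_nbr, P.exists_triangle_iff, mem_neighborSet]
    rw [hnbr, ← Finset.coe_image, Set.ncard_coe_finset, Set.ncard_coe_finset]
    by_cases hdeg : 3 ≤ (IsTriangulatedSphere.nbr P.triangle v).card
    · exact (min_le_left _ _).trans (hφ.three_le v (Finset.mem_univ v) hdeg)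
    refine (min_le_right _ _).trans (le_trans (b := 2) (by omega) ?_)
    obtain ⟨p, s, hps⟩ := (h.mem_iff v).1 (Finset.mem_univ v)
    obtain ⟨_, hs⟩ := h.symm (h.cyc (h.cyc hps))
    exact Finset.one_lt_card.2 ⟨_,
      Finset.mem_image_of_mem _ (IsTriangulatedSphere.mem_nbr.2 ⟨_, hps⟩), _,
      Finset.mem_image_of_mem _ (IsTriangulatedSphere.mem_nbr.2 ⟨_, hs⟩), hφ.proper (h.cyc hps)⟩
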